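/- arXiv:math/0605030 — 4 statements merged into one kernel-verified Lean document; each statement's English description precedes it below -/
import Mathlib

section
/- Let E be a universally complete K-space with a distinguished weak order unit 1. Then E can be endowed, in a unique way, with a multiplication making E a faithful f-algebra in which 1 is a ring unit; moreover, in this f-algebra every band projection π ∈ 𝔓(E) coincides with the operator of multiplication by π(1). -/
/-! Statement 1: A universally complete K-space `E` with weak order unit `1` carries a unique
multiplication making it a faithful f-algebra with ring unit `1`; in this f-algebra every band
projection `π` is the operator of multiplication by `π 1`. -/

universe u

variable {E : Type u}

/-- A band projection. -/
def IsBandProjection [Lattice E] [AddCommGroup E] [Module ℝ E] (π : E →ₗ[ℝ] E) : Prop :=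
  π.comp π = π ∧ ∀ x : E, 0 ≤ x → 0 ≤ π x ∧ π x ≤ x

/-- `mul` (an ℝ-bilinear map) makes `E` a faithful f-algebra with ring unit `one`:
it is associative, `one` is a two-sided unit, products of positive elements are positive
(lattice-ordered algebra), the f-algebra property holds, and faithfulness holds:
`x * y = 0 ↔ x ⊥ y`. -/
def IsFaithfulFAlgebraMul [Lattice E] [AddCommGroup E] [Module ℝ E]
    (one : E) (mul : E →ₗ[ℝ] E →ₗ[ℝ] E) : Prop :=
  (∀ x y z : E, mul (mul x y) z = mul x (mul y z)) ∧
  (∀ x : E, mul one x = x) ∧ (∀ x : E, mul x one = x) ∧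
  (∀ x y : E, 0 ≤ x → 0 ≤ y → 0 ≤ mul x y) ∧
  (∀ x y z : E, x ⊓ y = 0 → 0 ≤ z → mul z x ⊓ y = 0 ∧ mul x z ⊓ y = 0) ∧
  (∀ x y : E, mul x y = 0 ↔ |x| ⊓ |y| = 0)

theorem inf_eq_zero_of_le [Lattice E] [Zero E] {x y x' y' : E} (h : x ⊓ y = 0) (hx' : 0 ≤ x') (hy' : 0 ≤ y')
    (hx : x' ≤ x) (hy : y' ≤ y) : x' ⊓ y' = 0 :=
  le_antisymm (h ▸ inf_le_inf hx hy) (le_inf hx' hy')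

section LatticeGroup

variable [Lattice E] [AddCommGroup E] [IsOrderedAddMonoid E]

theorem le_of_le_add_of_inf_eq_zero {a b c d : E} (hb : 0 ≤ b) (hcd : c ⊓ d = 0)
    (h₁ : a ≤ b + c) (h₂ : a ≤ d) : a ≤ b := by
  have h : a - b ≤ c ⊓ d :=
    le_inf (sub_le_iff_le_add'.2 h₁) ((sub_le_self a hb).trans h₂)
  rwa [hcd, sub_nonpos] at h

theorem add_inf_eq_zero {x x' y : E} (hx : x ⊓ y = 0) (hx' : x' ⊓ y = 0) :
    (x + x') ⊓ y = 0 := by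
  have h0 : 0 ≤ x := hx ▸ inf_le_left
  have h0' : 0 ≤ x' := hx' ▸ inf_le_left
  have hy : 0 ≤ y := hx ▸ inf_le_right
  refine le_antisymm ?_ (le_inf (add_nonneg h0 h0') hy)
  rw [← hx']
  refine le_inf ?_ inf_le_right
  exact le_of_le_add_of_inf_eq_zero h0' hx (inf_le_left.trans (add_comm x x').le) inf_le_right

theorem nsmul_inf_eq_zero {x y : E} (h : x ⊓ y = 0) (n : ℕ) : (n • x) ⊓ y = 0 := by
  induction n with
  | zero => simpa using (h ▸ inf_le_right : 0 ≤ y)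
  | succ n ih => rw [succ_nsmul]; exact add_inf_eq_zero ih h

theorem posPart_inf_posPart_eq_zero_of_le_neg {a b : E} (h : a ≤ -b) : a⁺ ⊓ b⁺ = 0 := by
  refine inf_eq_zero_of_le (posPart_inf_negPart_eq_zero b) (posPart_nonneg b) (posPart_nonneg a)
    le_rfl ?_ |> fun h => inf_comm (a := a⁺) (b := b⁺) ▸ h
  rw [negPart_def]
  exact sup_le_sup_right h 0

theorem eq_zero_of_inf_level_eq_zero
    (hArch : ∀ x y : E, (∀ n : ℕ, n • x ≤ y) → x ≤ 0) {one : E} (hone : 0 ≤ one)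
    (hunit : ∀ w : E, w ⊓ one = 0 → w = 0) {w x : E} (hw : 0 ≤ w)
    (h : ∀ n : ℕ, w ⊓ (n • one - x)⁺ = 0) (hx : 0 ≤ x) : w = 0 := by
  apply hunit
  refine le_antisymm (hArch _ x fun n => ?_) (le_inf hw hone)
  have h₁ : (n • (w ⊓ one) - x)⁺ ≤ (n • one - x)⁺ :=
    posPart_mono (sub_le_sub_right (nsmul_le_nsmul_right inf_le_right n) x)
  have h₂ : (n • (w ⊓ one) - x)⁺ ≤ n • w :=
    sup_le ((sub_le_self _ hx).trans (nsmul_le_nsmul_right inf_le_left n)) (nsmul_nonneg hw n)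
  have h₃ := (le_inf h₂ h₁).trans (nsmul_inf_eq_zero (h n) n).le
  exact sub_nonpos.1 ((le_posPart _).trans h₃)

end LatticeGroup

section VectorLattice

variable [Lattice E] [AddCommGroup E] [Module ℝ E] [IsOrderedAddMonoid E] [PosSMulMono ℝ E]

theorem smul_le_smul_of_le_of_nonneg {c d : ℝ} {x : E} (h : c ≤ d) (hx : 0 ≤ x) :
    c • x ≤ d • x := by
  rw [← sub_nonneg, ← sub_smul]
  exact smul_nonneg (sub_nonneg.2 h) hx

theorem smul_inf_eq_zero {x y : E} {c : ℝ} (hc : 0 ≤ c) (h : x ⊓ y = 0) : (c • x) ⊓ y = 0 := by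
  have hx : 0 ≤ x := h ▸ inf_le_left
  obtain ⟨n, hn⟩ := exists_nat_ge c
  refine inf_eq_zero_of_le (nsmul_inf_eq_zero h n) (smul_nonneg hc hx) (h ▸ inf_le_right) ?_ le_rfl
  rw [← Nat.cast_smul_eq_nsmul ℝ]
  exact smul_le_smul_of_le_of_nonneg hn hx

theorem smul_inf_smul_eq_zero {x y : E} {c d : ℝ} (hc : 0 ≤ c) (hd : 0 ≤ d) (h : x ⊓ y = 0) :
    (c • x) ⊓ (d • y) = 0 := by
  rw [inf_comm]
  apply smul_inf_eq_zero hd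
  rw [inf_comm]
  exact smul_inf_eq_zero hc h

theorem posPart_inf_posPart_eq_zero_of_add_smul_nonpos {a b : E} {c : ℝ} (hc : 0 ≤ c)
    (h : a + c • b ≤ 0) : a⁺ ⊓ b⁺ = 0 := by
  have h₁ : a⁺ ≤ c • b⁻ := by
    refine sup_le ?_ (smul_nonneg hc (negPart_nonneg b))
    calc a ≤ c • (-b) := by rw [smul_neg]; exact le_neg_iff_add_nonpos_right.2 h
      _ ≤ c • b⁻ := smul_le_smul_of_nonneg_left (neg_le_negPart b) hc
  refine inf_eq_zero_of_le (smul_inf_eq_zero hc ?_) (posPart_nonneg a) (posPart_nonneg b)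
    h₁ le_rfl
  rw [inf_comm, posPart_inf_negPart_eq_zero]

/-- The bumps `(2 - |x - s|)⁺` of radius two around distant levels of `x` are disjoint. -/
theorem bump_inf_bump_eq_zero {one : E} (hone : 0 ≤ one) (x : E) {s t : ℝ} (h : 4 ≤ |s - t|) :
    ((2 : ℝ) • one - |x - s • one|)⁺ ⊓ ((2 : ℝ) • one - |x - t • one|)⁺ = 0 := by
  apply posPart_inf_posPart_eq_zero_of_le_neg
  have h₁ : (4 : ℝ) • one ≤ |x - s • one| + |x - t • one| := by
    rcases le_abs'.1 h with h | h
    · calc (4 : ℝ) • one ≤ (t - s) • one := smul_le_smul_of_le_of_nonneg (by linarith) hone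
        _ = (x - s • one) + -(x - t • one) := by module
        _ ≤ _ := add_le_add (le_abs_self _) (neg_le_abs _)
    · calc (4 : ℝ) • one ≤ (s - t) • one := smul_le_smul_of_le_of_nonneg (by linarith) hone
        _ = -(x - s • one) + (x - t • one) := by module
        _ ≤ _ := add_le_add (neg_le_abs _) (le_abs_self _)
  rw [← sub_nonneg] at h₁ ⊢
  convert h₁ using 1
  module

theorem exists_bump_bound
    (hUniv : ∀ A : Set E, (∀ x ∈ A, 0 ≤ x) →
      (A.Pairwise fun x y => |x| ⊓ |y| = 0) → BddAbove A)
    {one : E} (hone : 0 ≤ one) (x : E) :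
    ∃ b : E, ∀ n : ℕ, ((n : ℝ) ^ 2) • ((2 : ℝ) • one - |x - (n : ℝ) • one|) ≤ b := by
  set g : ℕ → E := fun n => ((n : ℝ) ^ 2) • ((2 : ℝ) • one - |x - (n : ℝ) • one|)⁺ with hg
  have hg0 : ∀ n, 0 ≤ g n := fun n => smul_nonneg (sq_nonneg _) (posPart_nonneg _)
  have key : ∀ i : ℕ, ∃ b : E, ∀ k : ℕ, g (4 * k + i) ≤ b := by
    intro i
    obtain ⟨b, hb⟩ := hUniv (Set.range fun k : ℕ => g (4 * k + i))
      (by rintro _ ⟨k, rfl⟩; exact hg0 _) (by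
        rintro _ ⟨k, rfl⟩ _ ⟨l, rfl⟩ hkl
        have hne : k ≠ l := fun h => hkl (by rw [h])
        rw [abs_of_nonneg (hg0 _), abs_of_nonneg (hg0 _)]
        refine smul_inf_smul_eq_zero (sq_nonneg _) (sq_nonneg _) (bump_inf_bump_eq_zero hone x ?_)
        have h1 : (1 : ℤ) ≤ |(k : ℤ) - l| := Int.one_le_abs (by omega)
        have h2 : (1 : ℝ) ≤ |(k : ℝ) - l| := by exact_mod_cast h1
        push_cast
        rw [show (4 * (k : ℝ) + i) - (4 * l + i) = 4 * ((k : ℝ) - l) by ring, abs_mul]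
        norm_num
        exact h2)
    exact ⟨b, fun k => hb ⟨k, rfl⟩⟩
  choose b hb using key
  refine ⟨b 0 ⊔ b 1 ⊔ b 2 ⊔ b 3, fun n => ?_⟩
  refine (smul_le_smul_of_nonneg_left (le_posPart _) (sq_nonneg _)).trans (?_ : g n ≤ _)
  have h := hb (n % 4) (n / 4)
  rw [Nat.div_add_mod] at h
  refine h.trans ?_
  have h4 : n % 4 < 4 := Nat.mod_lt _ (by norm_num)
  interval_cases n % 4
  · exact le_sup_left.trans (le_sup_left.trans le_sup_left)
  · exact le_sup_right.trans (le_sup_left.trans le_sup_left)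
  · exact le_sup_right.trans le_sup_left
  · exact le_sup_right

/-- The parabola supporting lines `2 t x - t²` are bounded above as `t` varies. -/
theorem exists_parabola_bound_of_nonneg
    (hArch : ∀ x y : E, (∀ n : ℕ, n • x ≤ y) → x ≤ 0)
    (hUniv : ∀ A : Set E, (∀ x ∈ A, 0 ≤ x) →
      (A.Pairwise fun x y => |x| ⊓ |y| = 0) → BddAbove A)
    {one : E} (hone : 0 ≤ one) (hunit : ∀ w : E, w ⊓ one = 0 → w = 0) {x : E} (hx : 0 ≤ x) :
    ∃ b : E, ∀ t : ℝ, 0 ≤ t → (2 * t) • x - t ^ 2 • one ≤ b := by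
  obtain ⟨b, hb⟩ := exists_bump_bound hUniv hone x
  refine ⟨(2 : ℝ) • b + (2 : ℝ) • one, fun t ht => ?_⟩
  rw [← sub_nonpos]
  set h := (2 * t) • x - t ^ 2 • one - ((2 : ℝ) • b + (2 : ℝ) • one) with hh
  have hbump : ∀ n : ℕ, h⁺ ⊓ (one - |x - (n : ℝ) • one|)⁺ = 0 := by
    intro n
    apply posPart_inf_posPart_eq_zero_of_add_smul_nonpos (c := 2 * t + 2 * (n : ℝ) ^ 2)
      (by positivity)
    have h₁ : 0 ≤ (2 : ℝ) • (b - ((n : ℝ) ^ 2) • ((2 : ℝ) • one - |x - (n : ℝ) • one|)) :=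
      smul_nonneg (by norm_num) (sub_nonneg.2 (hb n))
    have h₂ : 0 ≤ (2 * t) • (|x - (n : ℝ) • one| - (x - (n : ℝ) • one)) :=
      smul_nonneg (by positivity) (sub_nonneg.2 (le_abs_self _))
    have h₃ : 0 ≤ ((t - (n + 1)) ^ 2 + ((n : ℝ) - 1) ^ 2) • one :=
      smul_nonneg (by positivity) hone
    rw [← neg_nonneg]
    have := add_nonneg (add_nonneg h₁ h₂) h₃
    convert this using 1
    rw [hh]
    module
  have hlevel : ∀ n : ℕ, h⁺ ⊓ ((n : ℝ) • one - x)⁺ = 0 := by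
    intro n
    induction n with
    | zero =>
      have : ((0 : ℕ) : ℝ) • one - x ≤ 0 := by simpa using hx
      rw [posPart_eq_zero.2 this]
      exact inf_eq_right.2 (posPart_nonneg h)
    | succ n ih =>
      have hsum := add_inf_eq_zero (add_inf_eq_zero ((inf_comm _ _).trans ih) ((inf_comm _ _).trans ih))
        ((inf_comm _ _).trans (hbump n))
      rw [inf_comm]
      refine inf_eq_zero_of_le hsum (posPart_nonneg _) (posPart_nonneg _) ?_ le_rfl
      refine sup_le ?_ (add_nonneg (add_nonneg (posPart_nonneg _) (posPart_nonneg _))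
        (posPart_nonneg _))
      set z := (n : ℝ) • one - x with hz
      have habs : |x - (n : ℝ) • one| = z⁺ + z⁻ := by
        rw [abs_sub_comm, posPart_add_negPart]
      have hzz : z⁺ - z⁻ = z := posPart_sub_negPart z
      calc ((n + 1 : ℕ) : ℝ) • one - x = z + one := by rw [hz]; push_cast; module
        _ = z⁺ + z⁺ + (one - |x - (n : ℝ) • one|) := by rw [habs]; nth_rewrite 1 [← hzz]; abel
        _ ≤ _ := add_le_add_right (le_posPart _) _
  simp only [Nat.cast_smul_eq_nsmul] at hlevel
  exact posPart_eq_zero.1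
    (eq_zero_of_inf_level_eq_zero hArch hone hunit (posPart_nonneg h) hlevel hx)

end VectorLattice

/-- A positive orthomorphism: a positive operator preserving disjointness from every element. -/
structure IsPosOrthomorphism [Lattice E] [AddCommGroup E] [Module ℝ E] (S : E →ₗ[ℝ] E) :
    Prop where
  nonneg : ∀ x, 0 ≤ x → 0 ≤ S x
  disjoint : ∀ x y, x ⊓ y = 0 → S x ⊓ y = 0

section Orthomorphism

variable [Lattice E] [AddCommGroup E] [Module ℝ E] [IsOrderedAddMonoid E]

theorem LinearMap.ext_of_nonneg {F : Type*} [AddCommGroup F] [Module ℝ F] {S T : E →ₗ[ℝ] F}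
    (h : ∀ x, 0 ≤ x → S x = T x) : S = T := by
  ext x
  rw [← posPart_sub_negPart x, map_sub, map_sub, h _ (posPart_nonneg x), h _ (negPart_nonneg x)]

namespace IsPosOrthomorphism

variable {S T : E →ₗ[ℝ] E}

theorem mono (hS : IsPosOrthomorphism S) {x y : E} (h : x ≤ y) : S x ≤ S y := by
  rw [← sub_nonneg, ← map_sub]
  exact hS.nonneg _ (sub_nonneg.2 h)

theorem add (hS : IsPosOrthomorphism S) (hT : IsPosOrthomorphism T) :
    IsPosOrthomorphism (S + T) where
  nonneg x hx := add_nonneg (hS.nonneg x hx) (hT.nonneg x hx)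
  disjoint x y h := add_inf_eq_zero (hS.disjoint x y h) (hT.disjoint x y h)

omit [IsOrderedAddMonoid E] in
theorem comp (hS : IsPosOrthomorphism S) (hT : IsPosOrthomorphism T) :
    IsPosOrthomorphism (S.comp T) where
  nonneg x hx := hS.nonneg _ (hT.nonneg x hx)
  disjoint x y h := hS.disjoint _ _ (hT.disjoint x y h)

theorem inf_le_map_inf (hS : IsPosOrthomorphism S) (a b : E) : S a ⊓ S b ≤ S (a ⊓ b) := by
  have h : (a - a ⊓ b) ⊓ (b - a ⊓ b) = 0 := by rw [← inf_sub, sub_self]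
  have h' := hS.disjoint _ _ h
  rw [inf_comm] at h'
  have h'' := hS.disjoint _ _ h'
  rw [map_sub, map_sub, ← inf_sub, sub_eq_zero, inf_comm] at h''
  exact h''.le

theorem sub_le (hS : IsPosOrthomorphism S) (hT : IsPosOrthomorphism T) {one : E}
    (h : S one = T one) (y : E) (t : ℝ) : S y - T y ≤ (S + T) |y - t • one| := by
  have h₁ : S y - T y = S (y - t • one) + T (-(y - t • one)) := by
    simp only [map_sub, map_neg, map_smul, h]
    abel
  rw [h₁]
  exact add_le_add (hS.mono (le_abs_self _)) (hT.mono (neg_le_abs _))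

end IsPosOrthomorphism

theorem add_posPart_inf_abs_le [PosSMulMono ℝ E] (e z : E) :
    (e + (z + e)⁺) ⊓ |z| ≤ e + z⁺ := by
  let _ : DistribLattice E := AddCommGroup.toDistribLattice E
  have h1 : e + (z + e)⁺ ≤ (e + z⁺) ⊔ (e + (z + e)) := by
    rw [posPart_def, add_sup, add_zero]
    exact sup_le le_sup_right ((le_add_of_nonneg_right (posPart_nonneg z)).trans le_sup_left)
  refine (inf_le_inf_right _ h1).trans ?_
  rw [inf_sup_right]
  refine sup_le inf_le_left ?_
  have h2 : (2 : ℝ) • ((e + (z + e)) ⊓ |z|) ≤ (2 : ℝ) • (e + z⁺) := by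
    rw [two_smul]
    calc _ ≤ (e + (z + e)) + |z| := add_le_add inf_le_left inf_le_right
      _ = _ := by
        rw [← posPart_add_negPart z]
        nth_rewrite 1 [← posPart_sub_negPart z]
        module
  have := smul_le_smul_of_nonneg_left h2 (by norm_num : (0 : ℝ) ≤ 2⁻¹)
  simpa [smul_smul] using this

/-- Two positive orthomorphisms agreeing at the unit compare at every positive element whose
square `q` exists. -/
theorem IsPosOrthomorphism.le_of_map_one_eq [PosSMulMono ℝ E]
    (hArch : ∀ x y : E, (∀ n : ℕ, n • x ≤ y) → x ≤ 0) {one : E} (hone : 0 ≤ one)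
    {S T : E →ₗ[ℝ] E} (hS : IsPosOrthomorphism S) (hT : IsPosOrthomorphism T)
    (h : S one = T one) {y q : E} (hy : 0 ≤ y)
    (hq : ∀ t : ℝ, (2 * t) • y - t ^ 2 • one ≤ q) : S y ≤ T y := by
  have hU := hS.add hT
  set U := S + T
  have hq0 : 0 ≤ q := by simpa using hq 0
  have step : ∀ e : ℝ, 0 ≤ e → ∀ n : ℕ,
      S y - T y ≤ U (e • one + (y - (n * e) • one)⁺) := by
    intro e he n
    have heone : 0 ≤ e • one := smul_nonneg he hone
    induction n with
    | zero =>
      refine (hS.sub_le hT h y 0).trans (hU.mono ?_)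
      simp only [zero_smul, sub_zero, abs_of_nonneg hy, Nat.cast_zero, zero_mul,
        posPart_of_nonneg hy]
      exact le_add_of_nonneg_left heone
    | succ n ih =>
      refine (le_inf ih (hS.sub_le hT h y (((n + 1 : ℕ) : ℝ) * e))).trans
        ((hU.inf_le_map_inf _ _).trans (hU.mono ?_))
      have := add_posPart_inf_abs_le (e • one) (y - (((n + 1 : ℕ) : ℝ) * e) • one)
      rwa [show y - (((n + 1 : ℕ) : ℝ) * e) • one + e • one = y - (n * e) • one by
        push_cast; module] at this
  rw [← sub_nonpos]
  refine hArch _ (U (one + q)) fun n => ?_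
  rcases Nat.eq_zero_or_pos n with rfl | hn
  · simpa using hU.nonneg _ (add_nonneg hone hq0)
  have hn' : (0 : ℝ) < n := by exact_mod_cast hn
  have h₁ := smul_le_smul_of_nonneg_left (step (n : ℝ)⁻¹ (by positivity) (n * n)) hn'.le
  rw [Nat.cast_smul_eq_nsmul, ← map_smul] at h₁
  refine h₁.trans (hU.mono ?_)
  have h₂ : (y - (((n * n : ℕ) : ℝ) * (n : ℝ)⁻¹) • one)⁺ ≤ (n : ℝ)⁻¹ • q := by
    refine sup_le ?_ (smul_nonneg (by positivity) hq0)
    have h₃ := smul_le_smul_of_nonneg_left (hq (2 * n)) (by positivity : (0 : ℝ) ≤ (4 * (n : ℝ))⁻¹)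
    have h₄ : (4 * (n : ℝ))⁻¹ • q ≤ (n : ℝ)⁻¹ • q :=
      smul_le_smul_of_le_of_nonneg (by gcongr; linarith) hq0
    refine le_trans (le_of_eq ?_) (h₃.trans h₄)
    rw [smul_sub, smul_smul, smul_smul]
    congr 1
    · rw [show (4 * (n : ℝ))⁻¹ * (2 * (2 * n)) = 1 by field_simp; norm_num, one_smul]
    · congr 1
      push_cast
      field_simp
      norm_num
  have h₅ := smul_le_smul_of_nonneg_left h₂ hn'.le
  rw [smul_smul, mul_inv_cancel₀ hn'.ne', one_smul] at h₅
  rw [smul_add, smul_smul, mul_inv_cancel₀ hn'.ne', one_smul]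
  exact add_le_add_right h₅ _

end Orthomorphism

/-- `sq` is the squaring map with respect to the unit `one`: the square of `x` is the
supremum of the supporting lines `2 t x - t²` of the parabola. -/
def IsSquaring [Lattice E] [AddCommGroup E] [Module ℝ E] (one : E) (sq : E → E) : Prop :=
  ∀ x, IsLUB (Set.range fun t : ℝ => (2 * t) • x - t ^ 2 • one) (sq x)

/-- The product obtained from a squaring map by polarization. -/
noncomputable def polarProduct [AddCommGroup E] [Module ℝ E] (sq : E → E) (x y : E) : E :=
  (2 : ℝ)⁻¹ • (sq (x + y) - sq x - sq y)

theorem polarProduct_comm [AddCommGroup E] [Module ℝ E] (sq : E → E) (x y : E) :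
    polarProduct sq x y = polarProduct sq y x := by
  rw [polarProduct, polarProduct, add_comm y x]
  module

section Squaring

variable [Lattice E] [AddCommGroup E] [Module ℝ E] [IsOrderedAddMonoid E] [PosSMulMono ℝ E]

theorem exists_isSquaring
    (hArch : ∀ x y : E, (∀ n : ℕ, n • x ≤ y) → x ≤ 0)
    (hDedekind : ∀ A : Set E, A.Nonempty → BddAbove A → ∃ s : E, IsLUB A s)
    (hUniv : ∀ A : Set E, (∀ x ∈ A, 0 ≤ x) →
      (A.Pairwise fun x y => |x| ⊓ |y| = 0) → BddAbove A)
    {one : E} (hone : 0 ≤ one) (hunit : ∀ w : E, w ⊓ one = 0 → w = 0) :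
    ∃ sq : E → E, IsSquaring one sq := by
  have key : ∀ x : E, ∃ s, IsLUB (Set.range fun t : ℝ => (2 * t) • x - t ^ 2 • one) s := by
    intro x
    refine hDedekind _ (Set.range_nonempty _) ?_
    obtain ⟨b, hb⟩ := exists_parabola_bound_of_nonneg hArch hUniv hone hunit (abs_nonneg x)
    refine ⟨b, ?_⟩
    rintro _ ⟨t, rfl⟩
    refine le_trans ?_ (hb |t| (abs_nonneg t))
    simp only [sq_abs]
    apply sub_le_sub_right
    rcases le_total 0 t with ht | ht
    · rw [abs_of_nonneg ht]
      exact smul_le_smul_of_nonneg_left (le_abs_self x) (by linarith)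
    · rw [abs_of_nonpos ht, show (2 * t) • x = (2 * -t) • (-x) by module]
      exact smul_le_smul_of_nonneg_left (neg_le_abs x) (by linarith)
  choose sq hsq using key
  exact ⟨sq, hsq⟩

namespace IsSquaring

variable {one : E} {sq : E → E}

omit [IsOrderedAddMonoid E] [PosSMulMono ℝ E] in
theorem line_le (h : IsSquaring one sq) (x : E) (t : ℝ) :
    (2 * t) • x - t ^ 2 • one ≤ sq x :=
  (h x).1 ⟨t, rfl⟩

omit [IsOrderedAddMonoid E] [PosSMulMono ℝ E] in
theorem le_of_line_le (h : IsSquaring one sq) {x b : E}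
    (hb : ∀ t : ℝ, (2 * t) • x - t ^ 2 • one ≤ b) : sq x ≤ b :=
  (h x).2 (by rintro _ ⟨t, rfl⟩; exact hb t)

omit [IsOrderedAddMonoid E] [PosSMulMono ℝ E] in
theorem nonneg (h : IsSquaring one sq) (x : E) : 0 ≤ sq x := by
  simpa using h.line_le x 0

omit [IsOrderedAddMonoid E] in
theorem map_smul_le (h : IsSquaring one sq) {c : ℝ} (hc : c ≠ 0) (x : E) :
    sq (c • x) ≤ c ^ 2 • sq x := by
  refine h.le_of_line_le fun t => ?_
  refine le_trans (le_of_eq ?_) (smul_le_smul_of_nonneg_left (h.line_le x (t / c)) (sq_nonneg c))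
  rw [smul_sub, smul_smul, smul_smul, smul_smul]
  congr 2 <;> field_simp

omit [IsOrderedAddMonoid E] in
theorem map_smul (h : IsSquaring one sq) {c : ℝ} (hc : c ≠ 0) (x : E) :
    sq (c • x) = c ^ 2 • sq x := by
  refine le_antisymm (h.map_smul_le hc x) ?_
  have h₁ := smul_le_smul_of_nonneg_left (h.map_smul_le (inv_ne_zero hc) (c • x)) (sq_nonneg c)
  rwa [smul_smul, smul_smul, inv_mul_cancel₀ hc, one_smul, ← mul_pow, mul_inv_cancel₀ hc,
    one_pow, one_smul] at h₁

omit [IsOrderedAddMonoid E] in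
theorem map_neg (h : IsSquaring one sq) (x : E) : sq (-x) = sq x := by
  have := h.map_smul (c := -1) (by norm_num) x
  simpa using this

theorem add_sub_le (h : IsSquaring one sq) (x y : E) :
    sq (x + y) + sq (x - y) ≤ (2 : ℝ) • sq x + (2 : ℝ) • sq y := by
  rw [← le_sub_iff_add_le]
  refine h.le_of_line_le fun s => ?_
  rw [le_sub_comm]
  refine h.le_of_line_le fun t => ?_
  rw [← sub_nonneg]
  have h₁ := smul_nonneg (zero_le_two (α := ℝ)) (sub_nonneg.2 (h.line_le x ((s + t) / 2)))
  have h₂ := smul_nonneg (zero_le_two (α := ℝ)) (sub_nonneg.2 (h.line_le y ((s - t) / 2)))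
  convert add_nonneg h₁ h₂ using 1
  module

theorem parallelogram (h : IsSquaring one sq) (x y : E) :
    sq (x + y) + sq (x - y) = (2 : ℝ) • sq x + (2 : ℝ) • sq y := by
  refine le_antisymm (h.add_sub_le x y) ?_
  have h₁ := h.add_sub_le (x + y) (x - y)
  rw [show x + y + (x - y) = (2 : ℝ) • x by module,
    show x + y - (x - y) = (2 : ℝ) • y by module, h.map_smul two_ne_zero,
    h.map_smul two_ne_zero] at h₁
  have h₂ := smul_le_smul_of_nonneg_left h₁ (by norm_num : (0 : ℝ) ≤ 2⁻¹)
  convert h₂ using 1 <;> module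

theorem map_add_add (h : IsSquaring one sq) (x y z : E) :
    sq (x + y + z) = sq (x + y) + sq (y + z) + sq (x + z) - sq x - sq y - sq z := by
  have h₁ := h.parallelogram (x + z) y
  have h₂ := h.parallelogram x (z - y)
  have h₃ := h.parallelogram (x + y) z
  have h₄ := h.parallelogram z y
  rw [show x + z + y = x + y + z by abel] at h₁
  rw [show x + (z - y) = x + z - y by abel, show x - (z - y) = x + y - z by abel] at h₂
  rw [add_comm z y] at h₄
  have h₅ : (2 : ℝ) • sq (x + y + z) =
      (2 : ℝ) • (sq (x + y) + sq (y + z) + sq (x + z) - sq x - sq y - sq z) := by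
    linear_combination (norm := module) h₁ - h₂ + h₃ - (2 : ℝ) • h₄
  exact smul_right_injective E two_ne_zero h₅

theorem map_abs_le (h : IsSquaring one sq) (hone : 0 ≤ one) (x : E) : sq |x| ≤ sq x := by
  refine h.le_of_line_le fun t => ?_
  rcases le_or_gt t 0 with ht | ht
  · refine le_trans ?_ (h.nonneg x)
    rw [sub_nonpos]
    refine le_trans ?_ (smul_nonneg (sq_nonneg t) hone)
    rw [← neg_nonneg, ← neg_smul]
    exact smul_nonneg (by linarith) (abs_nonneg x)
  have hle : ∀ z, sq z = sq x → z ≤ (2 * t)⁻¹ • (sq x + t ^ 2 • one) := by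
    intro z hz
    have h₁ := smul_le_smul_of_nonneg_left (sub_le_iff_le_add.1 (h.line_le z t))
      (by positivity : (0 : ℝ) ≤ (2 * t)⁻¹)
    rwa [smul_smul, inv_mul_cancel₀ (by positivity), one_smul, hz] at h₁
  have h₂ := smul_le_smul_of_nonneg_left (abs_le'.2 ⟨hle x rfl, hle (-x) (h.map_neg x)⟩)
    (by positivity : (0 : ℝ) ≤ 2 * t)
  rw [smul_smul, mul_inv_cancel₀ (by positivity), one_smul] at h₂
  exact sub_le_iff_le_add.2 h₂

theorem map_sub_le (h : IsSquaring one sq) {x y : E} (hx : 0 ≤ x) (hy : 0 ≤ y) :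
    sq (x - y) ≤ sq (x + y) := by
  refine h.le_of_line_le fun t => ?_
  refine le_trans ?_ (h.line_le (x + y) |t|)
  rw [sq_abs]
  apply sub_le_sub_right
  rw [← sub_nonneg]
  have h₁ : 0 ≤ (2 * (|t| - t)) • x :=
    smul_nonneg (by have := le_abs_self t; linarith) hx
  have h₂ : 0 ≤ (2 * (|t| + t)) • y :=
    smul_nonneg (by have := neg_le_abs t; linarith) hy
  convert add_nonneg h₁ h₂ using 1
  module

theorem map_add_of_inf_eq_zero (h : IsSquaring one sq) (hone : 0 ≤ one) {x y : E}
    (hxy : x ⊓ y = 0) : sq (x + y) = sq (x - y) := by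
  refine le_antisymm ?_ (h.map_sub_le (hxy ▸ inf_le_left) (hxy ▸ inf_le_right))
  have : x + y = |x - y| := by
    rw [← sup_sub_inf_eq_abs_sub, ← inf_add_sup x y, inf_comm y x, sup_comm y x, hxy, zero_add, sub_zero]
  rw [this]
  exact h.map_abs_le hone _

theorem map_inf_eq_zero (h : IsSquaring one sq) (hone : 0 ≤ one) {x y : E} (hxy : x ⊓ y = 0) :
    sq x ⊓ y = 0 := by
  have hx : 0 ≤ x := hxy ▸ inf_le_left
  have hy : 0 ≤ y := hxy ▸ inf_le_right
  set w := sq x ⊓ y with hw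
  have hw0 : 0 ≤ w := le_inf (h.nonneg x) hy
  have hwx : x ⊓ w = 0 := inf_eq_zero_of_le hxy hx hw0 le_rfl inf_le_right
  have hle : sq x ≤ sq x - w := by
    refine h.le_of_line_le fun t => ?_
    rw [le_sub_iff_add_le]
    set l := (2 * t) • x - t ^ 2 • one
    have hl : l⁺ ≤ (2 * |t|) • x := by
      refine sup_le ?_ (smul_nonneg (by positivity) hx)
      refine (sub_le_self _ (smul_nonneg (sq_nonneg t) hone)).trans ?_
      exact smul_le_smul_of_le_of_nonneg (by have := le_abs_self t; linarith) hx
    have hlw : l⁺ ⊓ w = 0 := inf_eq_zero_of_le (smul_inf_eq_zero (by positivity) hwx)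
      (posPart_nonneg l) hw0 hl le_rfl
    calc l + w ≤ l⁺ + w := add_le_add_left (le_posPart l) w
      _ = l⁺ ⊔ w := by rw [← inf_add_sup, hlw, zero_add]
      _ ≤ sq x := sup_le (sup_le (h.line_le x t) (h.nonneg x)) inf_le_left
  exact le_antisymm (by simpa using hle) hw0

theorem map_add_one (h : IsSquaring one sq) (x : E) : sq (x + one) = sq x + (2 : ℝ) • x + one := by
  have key : ∀ z, sq (z + one) ≤ sq z + (2 : ℝ) • z + one := by
    intro z
    refine h.le_of_line_le fun t => ?_
    have h₁ := sub_nonneg.2 (h.line_le z (t - 1))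
    rw [← sub_nonneg]
    convert h₁ using 1
    module
  refine le_antisymm (key x) ?_
  have h₁ := key (-(x + one))
  rw [show -(x + one) + one = -x by abel, h.map_neg, h.map_neg] at h₁
  rw [← sub_nonneg] at h₁ ⊢
  convert h₁ using 1
  module

theorem map_one (h : IsSquaring one sq) (hone : 0 ≤ one) : sq one = one := by
  have h₀ : sq 0 = 0 := by
    refine le_antisymm (h.le_of_line_le fun t => ?_) (h.nonneg 0)
    simpa using smul_nonneg (sq_nonneg t) hone
  simpa [h₀] using h.map_add_one 0

theorem polarProduct_one (h : IsSquaring one sq) (hone : 0 ≤ one) (x : E) :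
    polarProduct sq x one = x := by
  rw [polarProduct, h.map_add_one, h.map_one hone]
  module

omit [IsOrderedAddMonoid E] in
theorem polarProduct_self (h : IsSquaring one sq) (x : E) : polarProduct sq x x = sq x := by
  rw [polarProduct, ← two_smul ℝ x, h.map_smul two_ne_zero]
  module

theorem polarProduct_eq (h : IsSquaring one sq) (x y : E) :
    polarProduct sq x y = (4 : ℝ)⁻¹ • (sq (x + y) - sq (x - y)) := by
  rw [polarProduct, eq_sub_of_add_eq' (h.parallelogram x y)]
  module

theorem polarProduct_nonneg (h : IsSquaring one sq) {x y : E} (hx : 0 ≤ x) (hy : 0 ≤ y) :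
    0 ≤ polarProduct sq x y := by
  rw [h.polarProduct_eq]
  exact smul_nonneg (by norm_num) (sub_nonneg.2 (h.map_sub_le hx hy))

theorem polarProduct_eq_zero (h : IsSquaring one sq) (hone : 0 ≤ one) {x y : E}
    (hxy : x ⊓ y = 0) : polarProduct sq x y = 0 := by
  rw [h.polarProduct_eq, h.map_add_of_inf_eq_zero hone hxy, sub_self, smul_zero]

theorem polarProduct_add (h : IsSquaring one sq) (x y z : E) :
    polarProduct sq (x + y) z = polarProduct sq x z + polarProduct sq y z := by
  rw [polarProduct, polarProduct, polarProduct, h.map_add_add]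
  module

theorem polarProduct_smul_of_nonneg (h : IsSquaring one sq)
    (hArch : ∀ x y : E, (∀ n : ℕ, n • x ≤ y) → x ≤ 0) {x y : E} (hx : 0 ≤ x) (hy : 0 ≤ y)
    (c : ℝ) : polarProduct sq (c • x) y = c • polarProduct sq x y := by
  let f : E →+ E := AddMonoidHom.mk' (fun x => polarProduct sq x y)
    fun a b => h.polarProduct_add a b y
  change f (c • x) = c • f x
  have hfx : 0 ≤ f x := h.polarProduct_nonneg hx hy
  have hmono : ∀ a b, a ≤ b → f a ≤ f b := fun a b hab => by
    rw [← sub_nonneg, ← _root_.map_sub]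
    exact h.polarProduct_nonneg (sub_nonneg.2 hab) hy
  have hint : ∀ m : ℤ, f ((m : ℝ) • x) = (m : ℝ) • f x := fun m => by
    rw [Int.cast_smul_eq_zsmul, Int.cast_smul_eq_zsmul, map_zsmul]
  have hnat : ∀ n : ℕ, f ((n * c) • x) = n • f (c • x) := fun n => by
    rw [mul_smul, Nat.cast_smul_eq_nsmul, map_nsmul]
  have hlow : ∀ n : ℕ, (⌊n * c⌋ : ℝ) • f x ≤ n • f (c • x) := fun n => by
    rw [← hint, ← hnat]
    exact hmono _ _ (smul_le_smul_of_le_of_nonneg (Int.floor_le _) hx)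
  have hupp : ∀ n : ℕ, n • f (c • x) ≤ (⌊n * c⌋ + 1 : ℝ) • f x := fun n => by
    have := hint (⌊n * c⌋ + 1)
    push_cast at this
    rw [← this, ← hnat]
    exact hmono _ _ (smul_le_smul_of_le_of_nonneg (Int.lt_floor_add_one _).le hx)
  apply le_antisymm
  · rw [← sub_nonpos]
    refine hArch _ (f x) fun n => ?_
    have h₁ : (⌊n * c⌋ + 1 : ℝ) • f x ≤ (n * c + 1) • f x :=
      smul_le_smul_of_le_of_nonneg (by linarith [Int.floor_le (n * c)]) hfx
    rw [nsmul_sub, sub_le_iff_le_add, ← Nat.cast_smul_eq_nsmul ℝ n (c • f x)]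
    refine (hupp n).trans (h₁.trans (le_of_eq ?_))
    module
  · rw [← sub_nonpos]
    refine hArch _ (f x) fun n => ?_
    have h₁ : (n * c - 1) • f x ≤ (⌊n * c⌋ : ℝ) • f x :=
      smul_le_smul_of_le_of_nonneg (by linarith [Int.lt_floor_add_one (n * c)]) hfx
    rw [nsmul_sub, sub_le_comm, ← Nat.cast_smul_eq_nsmul ℝ n (c • f x)]
    refine le_trans (le_of_eq ?_) (h₁.trans (hlow n))
    module

theorem polarProduct_smul (h : IsSquaring one sq)
    (hArch : ∀ x y : E, (∀ n : ℕ, n • x ≤ y) → x ≤ 0) (c : ℝ) (x y : E) :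
    polarProduct sq (c • x) y = c • polarProduct sq x y := by
  have hl : ∀ a b z, polarProduct sq (a - b) z = polarProduct sq a z - polarProduct sq b z :=
    fun a b z => by rw [eq_sub_iff_add_eq, ← h.polarProduct_add, sub_add_cancel]
  have hr : ∀ z a b, polarProduct sq z (a - b) = polarProduct sq z a - polarProduct sq z b :=
    fun z a b => by simp only [polarProduct_comm sq z, hl]
  rw [← posPart_sub_negPart x, ← posPart_sub_negPart y, smul_sub]
  simp only [hl, hr, h.polarProduct_smul_of_nonneg hArch, posPart_nonneg, negPart_nonneg]
  module

/-- The product associated with a squaring map, as a bilinear map. -/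
noncomputable def mul (h : IsSquaring one sq)
    (hArch : ∀ x y : E, (∀ n : ℕ, n • x ≤ y) → x ≤ 0) : E →ₗ[ℝ] E →ₗ[ℝ] E :=
  LinearMap.mk₂ ℝ (polarProduct sq) h.polarProduct_add (h.polarProduct_smul hArch)
    (fun x y z => by simp only [polarProduct_comm sq x, h.polarProduct_add])
    (fun c x y => by simp only [polarProduct_comm sq x, h.polarProduct_smul hArch])

theorem polarProduct_inf_eq_zero (h : IsSquaring one sq)
    (hArch : ∀ x y : E, (∀ n : ℕ, n • x ≤ y) → x ≤ 0) (hone : 0 ≤ one) {x y z : E}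
    (hxy : x ⊓ y = 0) (hz : 0 ≤ z) : polarProduct sq z x ⊓ y = 0 := by
  have hx : 0 ≤ x := hxy ▸ inf_le_left
  have hy : 0 ≤ y := hxy ▸ inf_le_right
  have hzx := h.polarProduct_nonneg hz hx
  refine le_antisymm (hArch _ (sq z) fun n => ?_) (le_inf hzx hy)
  refine le_of_le_add_of_inf_eq_zero (c := ((n : ℝ) ^ 2) • sq x) (d := n • y) (h.nonneg z) ?_ ?_
    (nsmul_le_nsmul_right inf_le_right n)
  · rw [← Nat.cast_smul_eq_nsmul ℝ n y]
    exact smul_inf_smul_eq_zero (by positivity) (by positivity) (h.map_inf_eq_zero hone hxy)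
  refine (nsmul_le_nsmul_right inf_le_left n).trans ?_
  have h₁ : polarProduct sq (z - (n : ℝ) • x) (z - (n : ℝ) • x) =
      sq z - (2 * (n : ℝ)) • polarProduct sq z x + ((n : ℝ) ^ 2) • sq x := by
    change h.mul hArch _ _ = _
    have hc : h.mul hArch x z = h.mul hArch z x := polarProduct_comm sq x z
    have hs : ∀ a, h.mul hArch a a = sq a := h.polarProduct_self
    have hm : polarProduct sq z x = h.mul hArch z x := rfl
    rw [hm]
    simp only [_root_.map_sub, LinearMap.sub_apply, _root_.map_smul, LinearMap.smul_apply, hc, hs]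
    module
  rw [h.polarProduct_self] at h₁
  have h₂ : 0 ≤ sq (z - (n : ℝ) • x) + n • polarProduct sq z x :=
    add_nonneg (h.nonneg _) (nsmul_nonneg hzx n)
  rw [h₁] at h₂
  rw [← sub_nonneg]
  convert h₂ using 1
  module

theorem isPosOrthomorphism_mul (h : IsSquaring one sq)
    (hArch : ∀ x y : E, (∀ n : ℕ, n • x ≤ y) → x ≤ 0) (hone : 0 ≤ one) {z : E} (hz : 0 ≤ z) :
    IsPosOrthomorphism (h.mul hArch z) where
  nonneg _ hx := h.polarProduct_nonneg hz hx
  disjoint _ _ hxy := h.polarProduct_inf_eq_zero hArch hone hxy hz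

theorem nonpos_of_map_eq_zero (h : IsSquaring one sq)
    (hArch : ∀ x y : E, (∀ n : ℕ, n • x ≤ y) → x ≤ 0) (hone : 0 ≤ one) {x : E} (hx : sq x = 0) :
    x ≤ 0 := by
  refine hArch x one fun n => ?_
  rcases Nat.eq_zero_or_pos n with rfl | hn
  · simpa using hone
  have hn' : (0 : ℝ) < n := by exact_mod_cast hn
  have h₁ := smul_le_smul_of_nonneg_left (hx ▸ h.line_le x (2 / n))
    (by positivity : (0 : ℝ) ≤ (n : ℝ) ^ 2 / 4)
  rw [smul_zero, smul_sub, smul_smul, smul_smul, sub_nonpos,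
    show (n : ℝ) ^ 2 / 4 * (2 * (2 / n)) = n by field_simp; norm_num,
    show (n : ℝ) ^ 2 / 4 * (2 / n) ^ 2 = 1 by field_simp; norm_num, one_smul,
    Nat.cast_smul_eq_nsmul] at h₁
  exact h₁

theorem mul_comm (h : IsSquaring one sq)
    (hArch : ∀ x y : E, (∀ n : ℕ, n • x ≤ y) → x ≤ 0) (x y : E) :
    h.mul hArch x y = h.mul hArch y x :=
  polarProduct_comm sq x y

theorem mul_inf_mul_eq_zero (h : IsSquaring one sq)
    (hArch : ∀ x y : E, (∀ n : ℕ, n • x ≤ y) → x ≤ 0) (hone : 0 ≤ one) {x y z w : E}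
    (hxy : x ⊓ y = 0) (hz : 0 ≤ z) (hw : 0 ≤ w) :
    h.mul hArch z x ⊓ h.mul hArch w y = 0 := by
  rw [inf_comm]
  apply (h.isPosOrthomorphism_mul hArch hone hw).disjoint
  rw [inf_comm]
  exact (h.isPosOrthomorphism_mul hArch hone hz).disjoint _ _ hxy

theorem mul_eq_zero_iff (h : IsSquaring one sq)
    (hArch : ∀ x y : E, (∀ n : ℕ, n • x ≤ y) → x ≤ 0) (hone : 0 ≤ one) (x y : E) :
    h.mul hArch x y = 0 ↔ |x| ⊓ |y| = 0 := by
  have hxp := posPart_nonneg x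
  have hxn := negPart_nonneg x
  have hyp := posPart_nonneg y
  have hyn := negPart_nonneg y
  have hexp : h.mul hArch x y =
      (h.mul hArch x⁺ y⁺ + h.mul hArch x⁻ y⁻) - (h.mul hArch x⁺ y⁻ + h.mul hArch x⁻ y⁺) := by
    conv_lhs => rw [← posPart_sub_negPart x, ← posPart_sub_negPart y]
    simp only [_root_.map_sub, LinearMap.sub_apply]
    abel
  have hexpabs : h.mul hArch |x| |y| =
      (h.mul hArch x⁺ y⁺ + h.mul hArch x⁻ y⁻) + (h.mul hArch x⁺ y⁻ + h.mul hArch x⁻ y⁺) := by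
    rw [← posPart_add_negPart x, ← posPart_add_negPart y]
    simp only [_root_.map_add, LinearMap.add_apply]
    abel
  constructor
  · intro hxy
    have hdisj : (h.mul hArch x⁺ y⁺ + h.mul hArch x⁻ y⁻) ⊓
        (h.mul hArch x⁺ y⁻ + h.mul hArch x⁻ y⁺) = 0 := by
      have hx := posPart_inf_negPart_eq_zero x
      have hy := posPart_inf_negPart_eq_zero y
      have hx' := (inf_comm _ _).trans hx
      have hy' := (inf_comm _ _).trans hy
      refine add_inf_eq_zero ?_ ?_ <;> rw [inf_comm] <;> refine add_inf_eq_zero ?_ ?_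
      · exact h.mul_inf_mul_eq_zero hArch hone hy' hxp hxp
      · rw [h.mul_comm hArch x⁻, h.mul_comm hArch x⁺]
        exact h.mul_inf_mul_eq_zero hArch hone hx' hyp hyp
      · rw [h.mul_comm hArch x⁻, h.mul_comm hArch x⁺]
        exact h.mul_inf_mul_eq_zero hArch hone hx hyn hyn
      · exact h.mul_inf_mul_eq_zero hArch hone hy hxn hxn
    rw [hexp, sub_eq_zero] at hxy
    rw [hxy, inf_idem] at hdisj
    rw [hxy, hdisj, add_zero] at hexpabs
    have hu : 0 ≤ |x| ⊓ |y| := le_inf (abs_nonneg x) (abs_nonneg y)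
    refine le_antisymm (h.nonpos_of_map_eq_zero hArch hone (le_antisymm ?_ (h.nonneg _))) hu
    rw [← h.polarProduct_self, ← hexpabs]
    calc h.mul hArch (|x| ⊓ |y|) (|x| ⊓ |y|) ≤ h.mul hArch (|x| ⊓ |y|) |y| :=
          (h.isPosOrthomorphism_mul hArch hone hu).mono inf_le_right
      _ ≤ h.mul hArch |x| |y| := by
          rw [h.mul_comm hArch _ |y|, h.mul_comm hArch _ |y|]
          exact (h.isPosOrthomorphism_mul hArch hone (abs_nonneg y)).mono inf_le_left
  · intro hxy
    have hzero : ∀ a b : E, 0 ≤ a → 0 ≤ b → a ≤ |x| → b ≤ |y| → h.mul hArch a b = 0 :=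
      fun a b ha hb hax hby =>
        h.polarProduct_eq_zero hone (inf_eq_zero_of_le hxy ha hb hax hby)
    have hp : ∀ z : E, z⁺ ≤ |z| := fun z => sup_le (le_abs_self z) (abs_nonneg z)
    have hn : ∀ z : E, z⁻ ≤ |z| := fun z => sup_le (neg_le_abs z) (abs_nonneg z)
    rw [hexp, hzero _ _ hxp hyp (hp x) (hp y), hzero _ _ hxn hyn (hn x) (hn y),
      hzero _ _ hxp hyn (hp x) (hn y), hzero _ _ hxn hyp (hn x) (hp y)]
    simp

/-- Positive orthomorphisms are determined by their value at the unit. -/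
theorem isPosOrthomorphism_ext (h : IsSquaring one sq)
    (hArch : ∀ x y : E, (∀ n : ℕ, n • x ≤ y) → x ≤ 0) (hone : 0 ≤ one) {S T : E →ₗ[ℝ] E}
    (hS : IsPosOrthomorphism S) (hT : IsPosOrthomorphism T) (hST : S one = T one) : S = T :=
  LinearMap.ext_of_nonneg fun x hx => le_antisymm
    (hS.le_of_map_one_eq hArch hone hT hST hx (h.line_le x))
    (hT.le_of_map_one_eq hArch hone hS hST.symm hx (h.line_le x))

theorem mul_left_comm (h : IsSquaring one sq)
    (hArch : ∀ x y : E, (∀ n : ℕ, n • x ≤ y) → x ≤ 0) (hone : 0 ≤ one) (x y z : E) :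
    h.mul hArch x (h.mul hArch z y) = h.mul hArch z (h.mul hArch x y) := by
  let B := h.mul hArch
  have key : ∀ x, 0 ≤ x → ∀ z, 0 ≤ z → (B x).comp (B z) = (B z).comp (B x) := by
    intro x hx z hz
    have hBx := h.isPosOrthomorphism_mul hArch hone hx
    have hBz := h.isPosOrthomorphism_mul hArch hone hz
    refine h.isPosOrthomorphism_ext hArch hone (hBx.comp hBz) (hBz.comp hBx) ?_
    change B x (polarProduct sq z one) = B z (polarProduct sq x one)
    rw [h.polarProduct_one hone, h.polarProduct_one hone]
    exact h.mul_comm hArch x z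
  have key₁ : ∀ x, 0 ≤ x → B x ∘ₗ B.flip y = B.flip (B x y) := fun x hx =>
    LinearMap.ext_of_nonneg fun z hz => LinearMap.congr_fun (key x hx z hz) y
  have key₂ : B.flip (B z y) = B z ∘ₗ B.flip y :=
    LinearMap.ext_of_nonneg fun x hx => LinearMap.congr_fun (key₁ x hx) z
  exact LinearMap.congr_fun key₂ x

theorem isFaithfulFAlgebraMul_mul (h : IsSquaring one sq)
    (hArch : ∀ x y : E, (∀ n : ℕ, n • x ≤ y) → x ≤ 0) (hone : 0 ≤ one) :
    IsFaithfulFAlgebraMul one (h.mul hArch) := by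
  refine ⟨fun x y z => ?_, fun x => ?_, h.polarProduct_one hone,
    fun x y => h.polarProduct_nonneg, fun x y z hxy hz => ?_, h.mul_eq_zero_iff hArch hone⟩
  · rw [h.mul_comm hArch _ z, h.mul_left_comm hArch hone, h.mul_comm hArch z y]
  · rw [h.mul_comm hArch]
    exact h.polarProduct_one hone x
  · have hd := (h.isPosOrthomorphism_mul hArch hone hz).disjoint x y hxy
    exact ⟨hd, h.mul_comm hArch x z ▸ hd⟩

end IsSquaring

end Squaring

theorem universally_complete_Kspace_unique_faithful_fAlgebra
    [Lattice E] [AddCommGroup E] [Module ℝ E]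
    [CovariantClass E E (· + ·) (· ≤ ·)] [PosSMulMono ℝ E]
    (hArch : ∀ x y : E, (∀ n : ℕ, n • x ≤ y) → x ≤ 0)
    (hDedekind : ∀ A : Set E, A.Nonempty → BddAbove A → ∃ s : E, IsLUB A s)
    (hUnivComplete : ∀ A : Set E, (∀ x ∈ A, 0 ≤ x) →
      (A.Pairwise fun x y => |x| ⊓ |y| = 0) → BddAbove A)
    (one : E) (hone_pos : 0 ≤ one)
    (hone_unit : ∀ x : E, |x| ⊓ |one| = 0 → x = 0) :
    ∃ mul : E →ₗ[ℝ] E →ₗ[ℝ] E,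
      IsFaithfulFAlgebraMul one mul ∧
      (∀ mul' : E →ₗ[ℝ] E →ₗ[ℝ] E, IsFaithfulFAlgebraMul one mul' → mul' = mul) ∧
      (∀ π : E →ₗ[ℝ] E, IsBandProjection π → ∀ x : E, π x = mul (π one) x) := by
  have : IsOrderedAddMonoid E :=
    { add_le_add_left := fun a b hab c => by
        rw [add_comm a, add_comm b]
        exact CovariantClass.elim c hab }
  obtain ⟨sq, h⟩ := exists_isSquaring hArch hDedekind hUnivComplete hone_pos fun w hw =>
    hone_unit w (by rwa [abs_of_nonneg (hw ▸ inf_le_left), abs_of_nonneg hone_pos])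
  refine ⟨h.mul hArch, h.isFaithfulFAlgebraMul_mul hArch hone_pos, ?_, ?_⟩
  · rintro mul' ⟨-, -, hone', hpos, hdisj, -⟩
    refine LinearMap.ext_of_nonneg fun x hx => ?_
    refine h.isPosOrthomorphism_ext hArch hone_pos
      ⟨fun y => hpos x y hx, fun y z hyz => (hdisj y z x hyz hx).1⟩
      (h.isPosOrthomorphism_mul hArch hone_pos hx) ?_
    rw [hone']
    exact (h.polarProduct_one hone_pos x).symm
  · rintro π ⟨-, hπ⟩ x
    have hπ' : IsPosOrthomorphism π :=
      ⟨fun y hy => (hπ y hy).1, fun y z hyz =>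
        have hy : 0 ≤ y := hyz ▸ inf_le_left
        inf_eq_zero_of_le hyz (hπ y hy).1 (hyz ▸ inf_le_right) (hπ y hy).2 le_rfl⟩
    refine LinearMap.congr_fun (h.isPosOrthomorphism_ext hArch hone_pos hπ'
      (h.isPosOrthomorphism_mul hArch hone_pos (hπ one hone_pos).1) ?_) x
    exact (h.polarProduct_one hone_pos _).symm
end

section
/- Let G be a universally complete K-space (with a fixed weak order unit 1). Every band preserving linear operator T : G → G is order bounded if and only if G is locally one-dimensional. -/
/-! Statement 2: In a universally complete K-space `G` with a fixed weak order unit `1`,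
every band preserving linear operator `T : G → G` is order bounded if and only if `G` is
locally one-dimensional. -/

universe u

variable {E : Type u}

/-- A band preserving operator: `x ⊥ y` implies `T x ⊥ y`. -/
def BandPreserving [Lattice E] [AddCommGroup E] [Module ℝ E] (T : E →ₗ[ℝ] E) : Prop :=
  ∀ x y : E, |x| ⊓ |y| = 0 → |T x| ⊓ |y| = 0

/-- Order bounded: maps order intervals to order bounded sets. -/
def OrderBounded [Lattice E] [AddCommGroup E] [Module ℝ E] (T : E →ₗ[ℝ] E) : Prop :=
  ∀ a b : E, ∃ c d : E, ∀ x : E, a ≤ x → x ≤ b → c ≤ T x ∧ T x ≤ d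

lemma exists_maximal_disjoint [AddCommGroup E] [Module ℝ E]
    (S : Set (Module.End ℝ E)) :
    ∃ F ⊆ S, (F.Pairwise fun P Q => P * Q = 0) ∧
      ∀ P ∈ S, (∀ Q ∈ F, P * Q = 0 ∧ Q * P = 0) → P ∈ F := by
  obtain ⟨F, hF⟩ := zorn_subset
    {F : Set (Module.End ℝ E) | F ⊆ S ∧ F.Pairwise fun P Q => P * Q = 0}
    fun c hc hchain => ⟨⋃₀ c, ⟨Set.sUnion_subset fun F hF => (hc hF).1,
      (Set.pairwise_sUnion hchain.directedOn).2 fun F hF => (hc hF).2⟩,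
      fun F hF => Set.subset_sUnion_of_mem hF⟩
  refine ⟨F, hF.1.1, hF.1.2, fun P hP hPF => ?_⟩
  refine hF.2 (y := insert P F) ⟨Set.insert_subset hP hF.1.1, ?_⟩ (Set.subset_insert P F)
    (Set.mem_insert P F)
  exact Set.pairwise_insert.2 ⟨hF.1.2, fun Q hQ _ => hPF Q hQ⟩

section VectorLattice

variable [Lattice E] [AddCommGroup E]

lemma inf_eq_zero_of_le_s2 {a b c d : E} (ha : 0 ≤ a) (hb : 0 ≤ b) (hac : a ≤ c) (hbd : b ≤ d)
    (h : c ⊓ d = 0) : a ⊓ b = 0 :=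
  le_antisymm ((inf_le_inf hac hbd).trans h.le) (le_inf ha hb)

section Basic

variable [AddLeftMono E]

lemma eq_zero_of_abs_nonpos {x : E} (h : |x| ≤ 0) : x = 0 :=
  le_antisymm ((le_abs_self x).trans h) (neg_nonpos.1 ((neg_le_abs x).trans h))

lemma disjoint_of_abs_le {x x' y : E} (hx : |x'| ≤ |x|) (h : |x| ⊓ |y| = 0) : |x'| ⊓ |y| = 0 :=
  inf_eq_zero_of_le_s2 (abs_nonneg _) (abs_nonneg _) hx le_rfl h

lemma inf_add_le_of_nonneg {a b c : E} (ha : 0 ≤ a) (hb : 0 ≤ b) (hc : 0 ≤ c) :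
    (a + b) ⊓ c ≤ a ⊓ c + b ⊓ c := by
  rw [add_inf, inf_add, inf_add]
  refine le_inf (le_inf inf_le_left ?_) (le_inf ?_ ?_) <;> refine inf_le_right.trans ?_
  · exact le_add_of_nonneg_right hb
  · exact le_add_of_nonneg_left ha
  · exact le_add_of_nonneg_right hc

lemma disjoint_add {x x' y : E} (h : |x| ⊓ |y| = 0) (h' : |x'| ⊓ |y| = 0) :
    |x + x'| ⊓ |y| = 0 := by
  refine le_antisymm ?_ (le_inf (abs_nonneg _) (abs_nonneg _))
  calc |x + x'| ⊓ |y| ≤ (|x| + |x'|) ⊓ |y| := inf_le_inf (abs_add_le _ _) le_rfl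
    _ ≤ |x| ⊓ |y| + |x'| ⊓ |y| :=
      inf_add_le_of_nonneg (abs_nonneg _) (abs_nonneg _) (abs_nonneg _)
    _ = 0 := by rw [h, h', add_zero]

lemma disjoint_nsmul {x y : E} (h : |x| ⊓ |y| = 0) (n : ℕ) : |n • x| ⊓ |y| = 0 := by
  induction n with
  | zero => simp [abs_nonneg]
  | succ n ih => rw [succ_nsmul]; exact disjoint_add ih h

lemma abs_sub_eq_add_of_inf_eq_zero {a b : E} (h : a ⊓ b = 0) : |a - b| = a + b := by
  have h1 := sup_sub_inf_eq_abs_sub b a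
  have h2 := inf_add_sup a b
  rw [inf_comm, h, sub_zero, sup_comm] at h1
  rw [h, zero_add] at h2
  rw [← h1, h2]

end Basic

variable [Module ℝ E]

lemma abs_smul_le_smul_abs [AddLeftMono E] [PosSMulMono ℝ E] (c : ℝ) (x : E) :
    |c • x| ≤ |c| • |x| := by
  rw [abs_le']
  rcases le_total 0 c with hc | hc
  · rw [abs_of_nonneg hc, ← smul_neg]
    exact ⟨smul_le_smul_of_nonneg_left (le_abs_self x) hc,
      smul_le_smul_of_nonneg_left (neg_le_abs x) hc⟩
  · rw [abs_of_nonpos hc, ← neg_smul]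
    refine ⟨?_, smul_le_smul_of_nonneg_left (le_abs_self x) (neg_nonneg.2 hc)⟩
    rw [← neg_smul_neg]
    exact smul_le_smul_of_nonneg_left (neg_le_abs x) (neg_nonneg.2 hc)

lemma disjoint_smul [AddLeftMono E] [PosSMulMono ℝ E] {x y : E} (h : |x| ⊓ |y| = 0) (c : ℝ) :
    |c • x| ⊓ |y| = 0 := by
  obtain ⟨n, hn⟩ := exists_nat_ge |c|
  have h1 : |c • x| ≤ |n • abs x| := by
    refine (abs_smul_le_smul_abs c x).trans (le_trans ?_ (le_abs_self _))
    rw [← Nat.cast_smul_eq_nsmul ℝ, ← sub_nonneg, ← sub_smul]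
    exact smul_nonneg (sub_nonneg.2 hn) (abs_nonneg x)
  exact disjoint_of_abs_le h1 (disjoint_nsmul (by rwa [abs_abs]) n)

/-- The band of all elements disjoint from every element of `A`. -/
def disjointComplement [AddLeftMono E] [PosSMulMono ℝ E] (A : Set E) : Submodule ℝ E where
  carrier := {x | ∀ a ∈ A, |x| ⊓ |a| = 0}
  add_mem' hx hy a ha := disjoint_add (hx a ha) (hy a ha)
  zero_mem' a _ := by simp [abs_nonneg]
  smul_mem' c _ hx a ha := disjoint_smul (hx a ha) c

/-- Every nonempty set bounded above has a least upper bound. -/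
def DedekindComplete (E : Type*) [Lattice E] : Prop :=
  ∀ A : Set E, A.Nonempty → BddAbove A → ∃ s : E, IsLUB A s

namespace IsBandProjection

variable {P Q : Module.End ℝ E}

lemma apply_apply (hP : IsBandProjection P) (x : E) : P (P x) = P x :=
  LinearMap.congr_fun hP.1 x

lemma nonneg (hP : IsBandProjection P) {x : E} (hx : 0 ≤ x) : 0 ≤ P x := (hP.2 x hx).1

lemma le_self (hP : IsBandProjection P) {x : E} (hx : 0 ≤ x) : P x ≤ x := (hP.2 x hx).2

lemma mul_mul_eq (hP : IsBandProjection P) :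
    P * (P * Q) = P * Q := LinearMap.ext fun x => hP.apply_apply (Q x)

end IsBandProjection

variable [AddLeftMono E]

lemma exists_disjointComplement_decomposition [PosSMulMono ℝ E] (hE : DedekindComplete E)
    (A : Set E) {x : E} (hx : 0 ≤ x) :
    ∃ s, 0 ≤ s ∧ s ≤ x ∧ s ∈ disjointComplement A ∧
      x - s ∈ disjointComplement (disjointComplement A : Set E) := by
  obtain ⟨s, hs⟩ := hE {y | y ∈ disjointComplement A ∧ 0 ≤ y ∧ y ≤ x}
    ⟨0, zero_mem _, le_rfl, hx⟩ ⟨x, fun y hy => hy.2.2⟩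
  have hs0 : 0 ≤ s := hs.1 ⟨zero_mem _, le_rfl, hx⟩
  have hsx : s ≤ x := hs.2 fun y hy => hy.2.2
  have hsA : s ∈ disjointComplement A := by
    intro a ha
    rw [abs_of_nonneg hs0]
    refine le_antisymm ?_ (le_inf hs0 (abs_nonneg a))
    have h1 : s ≤ s ⊔ |a| - |a| := by
      refine hs.2 fun y hy => le_sub_iff_add_le.2 ?_
      have h2 := hy.1 a ha
      rw [abs_of_nonneg hy.2.1] at h2
      rw [← inf_add_sup, h2, zero_add]
      exact sup_le_sup_right (hs.1 hy) _
    have h2 := inf_add_sup s |a|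
    rw [← eq_sub_iff_add_eq] at h2
    rw [h2, sub_nonpos]
    exact le_sub_iff_add_le.1 h1
  refine ⟨s, hs0, hsx, hsA, fun z hz => ?_⟩
  rw [abs_of_nonneg (sub_nonneg.2 hsx)]
  have hw0 : 0 ≤ (x - s) ⊓ |z| := le_inf (sub_nonneg.2 hsx) (abs_nonneg z)
  have hwA : (x - s) ⊓ |z| ∈ disjointComplement A := fun a ha =>
    disjoint_of_abs_le (by rw [abs_of_nonneg hw0]; exact inf_le_right) (hz a ha)
  have h1 : s + (x - s) ⊓ |z| ≤ s := by
    refine hs.1 ⟨add_mem hsA hwA, add_nonneg hs0 hw0, ?_⟩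
    rw [← le_sub_iff_add_le']
    exact inf_le_left
  exact le_antisymm (by simpa using h1) hw0

lemma isCompl_disjointComplement [PosSMulMono ℝ E] (hE : DedekindComplete E) (A : Set E) :
    IsCompl (disjointComplement (disjointComplement A : Set E)) (disjointComplement A) := by
  refine ⟨Submodule.disjoint_def.2 fun x hx hx' => ?_, codisjoint_iff.2 (eq_top_iff.2 ?_)⟩
  · have h := hx x hx'
    rw [inf_idem] at h
    exact eq_zero_of_abs_nonpos h.le
  · have hpos : ∀ x : E, 0 ≤ x →
        x ∈ disjointComplement (disjointComplement A : Set E) ⊔ disjointComplement A := by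
      intro x hx
      obtain ⟨s, -, -, hs, hs'⟩ := exists_disjointComplement_decomposition hE A hx
      exact Submodule.mem_sup.2 ⟨x - s, hs', s, hs, sub_add_cancel x s⟩
    intro x _
    rw [← posPart_sub_negPart x]
    exact sub_mem (hpos _ (posPart_nonneg x)) (hpos _ (negPart_nonneg x))

/-- Every element of a Dedekind complete vector lattice generates a projection band. -/
lemma exists_isBandProjection [PosSMulMono ℝ E] (hE : DedekindComplete E) (d : E) :
    ∃ P : Module.End ℝ E, IsBandProjection P ∧ P d = d ∧ ∀ y, |y| ⊓ |d| = 0 → P y = 0 := by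
  have hc := isCompl_disjointComplement hE {d}
  refine ⟨Submodule.projection _ _ hc, ⟨?_, fun x hx => ?_⟩, ?_, fun y hy => ?_⟩
  · ext x
    exact Submodule.projection_apply_of_mem_left hc (Submodule.projection_apply_mem hc x)
  · obtain ⟨s, hs0, hsx, hs, hs'⟩ := exists_disjointComplement_decomposition hE {d} hx
    have h : Submodule.projection _ _ hc x = x - s := by
      conv_lhs => rw [← sub_add_cancel x s]
      rw [map_add, Submodule.projection_apply_of_mem_left hc hs',
        Submodule.projection_apply_of_mem_right hc hs, add_zero]
    rw [h]
    exact ⟨sub_nonneg.2 hsx, sub_le_self x hs0⟩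
  · exact Submodule.projection_apply_of_mem_left hc fun z hz => by
      rw [inf_comm]; exact hz d rfl
  · exact Submodule.projection_apply_of_mem_right hc fun a ha => by
      rw [Set.mem_singleton_iff.1 ha]; exact hy

namespace IsBandProjection

variable {P : Module.End ℝ E}

lemma mono (hP : IsBandProjection P) {x y : E} (h : x ≤ y) : P x ≤ P y := by
  rw [← sub_nonneg, ← map_sub]
  exact hP.nonneg (sub_nonneg.2 h)

lemma abs_apply (hP : IsBandProjection P) (x : E) : |P x| = P |x| := by
  conv_lhs => rw [← posPart_sub_negPart x]
  rw [map_sub, abs_sub_eq_add_of_inf_eq_zero, ← map_add, posPart_add_negPart]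
  exact inf_eq_zero_of_le_s2 (hP.nonneg (posPart_nonneg x)) (hP.nonneg (negPart_nonneg x))
    (hP.le_self (posPart_nonneg x)) (hP.le_self (negPart_nonneg x))
    (posPart_inf_negPart_eq_zero x)

lemma compl (hP : IsBandProjection P) : IsBandProjection (1 - P) := by
  refine ⟨?_, fun x hx => ⟨sub_nonneg.2 (hP.le_self hx), sub_le_self x (hP.nonneg hx)⟩⟩
  ext x
  simp [hP.apply_apply]

lemma disjoint_sub_apply (hP : IsBandProjection P) (x y : E) : |P x| ⊓ |y - P y| = 0 := by
  have hy : |y - P y| = |y| - P |y| := hP.compl.abs_apply y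
  rw [hP.abs_apply, hy]
  have hw0 : 0 ≤ P |x| ⊓ (|y| - P |y|) :=
    le_inf (hP.nonneg (abs_nonneg x)) (hP.compl.nonneg (abs_nonneg y))
  generalize hw : P |x| ⊓ (|y| - P |y|) = w at hw0
  have h1 := hP.mono (hw ▸ inf_le_right : w ≤ |y| - P |y|)
  have h2 := hP.compl.mono (hw ▸ inf_le_left : w ≤ P |x|)
  rw [map_sub, hP.apply_apply, sub_self] at h1
  simp only [LinearMap.sub_apply, Module.End.one_apply, hP.apply_apply, sub_self] at h2
  exact le_antisymm ((sub_nonpos.1 h2).trans h1) hw0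

lemma apply_posPart_eq_of_disjoint {z : E}
    (h : ∀ y, |y| ⊓ |z⁺| = 0 → P y = 0) (hz : P z⁺ = z⁺) : P z = z⁺ := by
  have h1 : P z⁻ = 0 := h _ <| by
    rw [abs_of_nonneg (negPart_nonneg z), abs_of_nonneg (posPart_nonneg z), inf_comm]
    exact posPart_inf_negPart_eq_zero z
  conv_lhs => rw [← posPart_sub_negPart z]
  rw [map_sub, h1, sub_zero, hz]

end IsBandProjection

lemma BandPreserving.apply_comm {T P : Module.End ℝ E} (hT : BandPreserving T)
    (hP : IsBandProjection P) (x : E) : T (P x) = P (T x) := by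
  have h1 : P (T (x - P x)) = 0 := by
    have h := hT (x - P x) (P (T (x - P x))) (by rw [inf_comm]; exact hP.disjoint_sub_apply _ _)
    rw [hP.abs_apply] at h
    refine eq_zero_of_abs_nonpos ?_
    rw [← h, hP.abs_apply]
    exact le_inf (hP.le_self (abs_nonneg _)) le_rfl
  have h2 : T (P x) - P (T (P x)) = 0 := by
    have h := hT (P x) (T (P x) - P (T (P x))) (hP.disjoint_sub_apply _ _)
    refine eq_zero_of_abs_nonpos ?_
    rw [← h]
    refine le_inf ?_ le_rfl
    have h' := hP.compl.abs_apply (T (P x))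
    have h'' := hP.compl.le_self (abs_nonneg (T (P x)))
    rw [← h'] at h''
    exact h''
  rw [map_sub, map_sub, sub_eq_zero] at h1
  rw [h1, ← sub_eq_zero, h2]

lemma IsBandProjection.bandPreserving {P : Module.End ℝ E} (hP : IsBandProjection P) :
    BandPreserving P := fun x y h =>
  disjoint_of_abs_le (by rw [hP.abs_apply]; exact hP.le_self (abs_nonneg x)) h

lemma bandPreserving_of_apply_comm [PosSMulMono ℝ E] (hE : DedekindComplete E)
    {T : Module.End ℝ E}
    (hT : ∀ P : Module.End ℝ E, IsBandProjection P → ∀ x, T (P x) = P (T x)) :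
    BandPreserving T := by
  intro x y h
  obtain ⟨P, hP, hPx, hPy⟩ := exists_isBandProjection hE x
  have h1 := hP.disjoint_sub_apply (T x) y
  rwa [← hT P hP, hPx, hPy y (by rwa [inf_comm]), sub_zero] at h1

namespace IsBandProjection

variable {P Q : Module.End ℝ E}

lemma apply_comm (hP : IsBandProjection P) (hQ : IsBandProjection Q) (x : E) :
    P (Q x) = Q (P x) := hP.bandPreserving.apply_comm hQ x

lemma mul (hP : IsBandProjection P) (hQ : IsBandProjection Q) : IsBandProjection (P * Q) := by
  refine ⟨LinearMap.ext fun x => ?_, fun x hx =>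
    ⟨hP.nonneg (hQ.nonneg hx), (hP.le_self (hQ.nonneg hx)).trans (hQ.le_self hx)⟩⟩
  change P (Q (P (Q x))) = P (Q x)
  rw [← hP.apply_comm hQ (Q x), hQ.apply_apply, hP.apply_apply]

lemma mul_eq_zero_of_apply_eq_zero (hQ : IsBandProjection Q) {d : E} (hQd : Q d = 0)
    (hPd : ∀ y, |y| ⊓ |d| = 0 → P y = 0) : P * Q = 0 := by
  ext x
  refine hPd _ ?_
  have h := hQ.disjoint_sub_apply x d
  rwa [hQd, sub_zero] at h

lemma eq_zero_of_apply_unit (hP : IsBandProjection P) {one : E}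
    (hone : ∀ x : E, |x| ⊓ |one| = 0 → x = 0) (h : P one = 0) : P = 0 := by
  ext x
  refine hone _ ?_
  have h' := hP.disjoint_sub_apply x one
  rwa [h, sub_zero] at h'

end IsBandProjection

/-- Inequalities may be checked locally. -/
lemma le_of_forall_exists_isBandProjection [PosSMulMono ℝ E] (hE : DedekindComplete E) {x y : E}
    (h : ∀ P : Module.End ℝ E, IsBandProjection P → P ≠ 0 →
      ∃ Q : Module.End ℝ E, IsBandProjection Q ∧ Q ≠ 0 ∧ P * Q = Q ∧ Q x ≤ Q y) : x ≤ y := by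
  obtain ⟨P, hP, hPz, hPy⟩ := exists_isBandProjection hE (x - y)⁺
  have hPxy := IsBandProjection.apply_posPart_eq_of_disjoint hPy hPz
  by_cases hP0 : P = 0
  · rw [← sub_nonpos, ← posPart_eq_zero, ← hPz, hP0, LinearMap.zero_apply]
  · obtain ⟨Q, hQ, hQ0, hPQ, hQxy⟩ := h P hP hP0
    refine absurd ?_ hQ0
    rw [← hPQ]
    refine hQ.mul_eq_zero_of_apply_eq_zero (le_antisymm ?_ (hQ.nonneg (posPart_nonneg _))) hPy
    rw [← hPxy, hQ.apply_comm hP, ← Module.End.mul_apply, hPQ, map_sub]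
    exact sub_nonpos.2 hQxy

lemma eq_of_forall_exists_isBandProjection [PosSMulMono ℝ E] (hE : DedekindComplete E) {x y : E}
    (h : ∀ P : Module.End ℝ E, IsBandProjection P → P ≠ 0 →
      ∃ Q : Module.End ℝ E, IsBandProjection Q ∧ Q ≠ 0 ∧ P * Q = Q ∧ Q x = Q y) : x = y := by
  refine le_antisymm ?_ ?_ <;> refine le_of_forall_exists_isBandProjection hE fun P hP hP0 => ?_ <;>
    obtain ⟨Q, hQ, hQ0, hPQ, hQxy⟩ := h P hP hP0
  · exact ⟨Q, hQ, hQ0, hPQ, hQxy.le⟩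
  · exact ⟨Q, hQ, hQ0, hPQ, hQxy.ge⟩

/-- Every set of pairwise disjoint positive elements is bounded above. -/
def DisjointlyBounded (E : Type*) [Lattice E] [AddCommGroup E] : Prop :=
  ∀ A : Set E, (∀ x ∈ A, 0 ≤ x) → (A.Pairwise fun x y => |x| ⊓ |y| = 0) → BddAbove A

lemma exists_glue_of_nonneg (hE : DedekindComplete E) (hU : DisjointlyBounded E) {ι : Type*}
    {P : ι → Module.End ℝ E} (hP : ∀ i, IsBandProjection (P i))
    (hPP : Pairwise fun i j => P i * P j = 0) {x : ι → E} (hx0 : ∀ i, 0 ≤ x i)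
    (hx : ∀ i, P i (x i) = x i) : ∃ e, ∀ i, P i e = x i := by
  rcases isEmpty_or_nonempty ι with hι | hι
  · exact ⟨0, fun i => (hι.false i).elim⟩
  have hPx : ∀ i j, i ≠ j → P i (x j) = 0 := fun i j hij => by
    rw [← hx j, ← Module.End.mul_apply, hPP hij, LinearMap.zero_apply]
  obtain ⟨s, hs⟩ := hE (Set.range x) (Set.range_nonempty x) <| by
    refine hU _ (Set.forall_mem_range.2 hx0) ?_
    rintro _ ⟨i, rfl⟩ _ ⟨j, rfl⟩ hij
    have h := (hP i).disjoint_sub_apply (x i) (x j)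
    rwa [hx i, hPx i j (fun h => hij (h ▸ rfl)), sub_zero] at h
  refine ⟨s, fun i => le_antisymm ?_ ?_⟩
  · have h1 : s ≤ x i + (s - P i s) := by
      refine hs.2 (Set.forall_mem_range.2 fun j => ?_)
      by_cases hij : i = j
      · subst hij
        exact le_add_of_nonneg_right ((hP i).compl.nonneg ((hx0 i).trans (hs.1 ⟨i, rfl⟩)))
      · refine le_add_of_nonneg_of_le (hx0 i) ?_
        have h := (hP i).compl.mono (hs.1 ⟨j, rfl⟩ : x j ≤ s)
        simpa [hPx i j hij] using h
    have h2 := (hP i).mono h1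
    rwa [map_add, map_sub, (hP i).apply_apply, sub_self, add_zero, hx i] at h2
  · rw [← hx i]
    exact (hP i).mono (hs.1 ⟨i, rfl⟩)

/-- Elements living on pairwise disjoint bands can be glued together. -/
lemma exists_glue (hE : DedekindComplete E) (hU : DisjointlyBounded E) {ι : Type*}
    {P : ι → Module.End ℝ E} (hP : ∀ i, IsBandProjection (P i))
    (hPP : Pairwise fun i j => P i * P j = 0) {x : ι → E}
    (hx : ∀ i, P i (x i) = x i) : ∃ e, ∀ i, P i e = x i := by
  have hpos : ∀ y : ι → E, (∀ i, 0 ≤ y i) → ∃ e, ∀ i, P i e = P i (y i) := fun y hy =>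
    exists_glue_of_nonneg hE hU hP hPP (fun i => (hP i).nonneg (hy i))
      fun i => (hP i).apply_apply _
  obtain ⟨e, he⟩ := hpos (fun i => (x i)⁺) fun i => posPart_nonneg _
  obtain ⟨f, hf⟩ := hpos (fun i => (x i)⁻) fun i => negPart_nonneg _
  refine ⟨e - f, fun i => ?_⟩
  rw [map_sub, he, hf, ← map_sub, posPart_sub_negPart, hx]

/-- A maximal family of pairwise disjoint band projections in a set of band projections meets
every nonzero member of that set. -/
lemma exists_maximal_disjoint_isBandProjection (S : Set (Module.End ℝ E))
    (hS : ∀ P ∈ S, IsBandProjection P) :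
    ∃ F ⊆ S, (F.Pairwise fun P Q => P * Q = 0) ∧ ∀ P ∈ S, P ≠ 0 → ∃ Q ∈ F, P * Q ≠ 0 := by
  obtain ⟨F, hFS, hFd, hF⟩ := exists_maximal_disjoint S
  refine ⟨F, hFS, hFd, fun P hP hP0 => ?_⟩
  by_contra! h
  have hPF : P ∈ F := hF P hP fun Q hQ => ⟨h Q hQ, by
    rw [← h Q hQ]
    exact LinearMap.ext fun x => (hS Q (hFS hQ)).apply_comm (hS P hP) x⟩
  exact hP0 ((hS P hP).1.symm.trans (h P hPF))

/-- Operators commuting with band projections which are locally scalar multiples of the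
identity. -/
def locallyScalar (E : Type*) [Lattice E] [AddCommGroup E] [Module ℝ E] [AddLeftMono E] :
    Subalgebra ℝ (Module.End ℝ E) where
  carrier := {r | (∀ P : Module.End ℝ E, IsBandProjection P → ∀ x, r (P x) = P (r x)) ∧
    ∀ P : Module.End ℝ E, IsBandProjection P → P ≠ 0 → ∃ Q : Module.End ℝ E,
      IsBandProjection Q ∧ Q ≠ 0 ∧ P * Q = Q ∧ ∃ c : ℝ, ∀ x, r (Q x) = c • Q x}
  mul_mem' {r s} hr hs := by
    refine ⟨fun P hP x => ?_, fun P hP hP0 => ?_⟩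
    · rw [Module.End.mul_apply, hs.1 P hP, hr.1 P hP, Module.End.mul_apply]
    · obtain ⟨Q, hQ, hQ0, hPQ, c, hc⟩ := hs.2 P hP hP0
      obtain ⟨Q', hQ', hQ'0, hQQ', c', hc'⟩ := hr.2 Q hQ hQ0
      refine ⟨Q', hQ', hQ'0, by rw [← hQQ', ← mul_assoc, hPQ], c' * c, fun x => ?_⟩
      have h : s (Q' x) = c • Q' x := by
        rw [← hQQ', Module.End.mul_apply, hc]
      rw [Module.End.mul_apply, h, map_smul, hc', smul_smul, mul_comm]
  add_mem' {r s} hr hs := by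
    refine ⟨fun P hP x => ?_, fun P hP hP0 => ?_⟩
    · rw [LinearMap.add_apply, hs.1 P hP, hr.1 P hP, LinearMap.add_apply, map_add]
    · obtain ⟨Q, hQ, hQ0, hPQ, c, hc⟩ := hs.2 P hP hP0
      obtain ⟨Q', hQ', hQ'0, hQQ', c', hc'⟩ := hr.2 Q hQ hQ0
      refine ⟨Q', hQ', hQ'0, by rw [← hQQ', ← mul_assoc, hPQ], c' + c, fun x => ?_⟩
      have h : s (Q' x) = c • Q' x := by
        rw [← hQQ', Module.End.mul_apply, hc]
      rw [LinearMap.add_apply, h, hc', add_smul]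
  algebraMap_mem' c := by
    refine ⟨fun P hP x => ?_, fun P hP hP0 => ⟨P, hP, hP0, hP.1, c, fun x => ?_⟩⟩
    · simp [Module.algebraMap_end_apply]
    · simp [Module.algebraMap_end_apply]

lemma IsBandProjection.mem_locallyScalar {P : Module.End ℝ E} (hP : IsBandProjection P) :
    P ∈ locallyScalar E := by
  refine ⟨fun Q hQ x => hP.apply_comm hQ x, fun Q hQ hQ0 => ?_⟩
  by_cases h : P * Q = 0
  · exact ⟨Q, hQ, hQ0, hQ.1, 0, fun x => by rw [zero_smul]; exact LinearMap.congr_fun h x⟩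
  · refine ⟨P * Q, hP.mul hQ, h, ?_, 1, fun x => by rw [one_smul]; exact hP.apply_apply _⟩
    ext x
    change Q (P (Q x)) = P (Q x)
    rw [← hP.apply_comm hQ, hQ.apply_apply]

/-- A universally complete vector lattice is injective over its ring of locally scalar
operators. -/
lemma baer_locallyScalar [PosSMulMono ℝ E] (hE : DedekindComplete E) (hU : DisjointlyBounded E) :
    Module.Baer (locallyScalar E) E := by
  intro I t
  obtain ⟨F, hFS, hFd, hF⟩ := exists_maximal_disjoint_isBandProjection
    {P : Module.End ℝ E | ∃ hP : IsBandProjection P,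
      (⟨P, hP.mem_locallyScalar⟩ : locallyScalar E) ∈ I} fun P hP => hP.1
  choose hFP hFI using fun P : F => hFS P.2
  obtain ⟨e, he⟩ := exists_glue hE hU (P := fun P : F => (P : Module.End ℝ E)) hFP
    (fun P Q hPQ => hFd P.2 Q.2 (Subtype.coe_injective.ne hPQ))
    (x := fun P => t ⟨_, hFI P⟩) <| fun P => by
      have h := t.map_smul (⟨P, (hFP P).mem_locallyScalar⟩ : locallyScalar E) ⟨_, hFI P⟩
      refine h.symm.trans (congrArg t (Subtype.ext (Subtype.ext ?_)))
      exact (hFP P).1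
  refine ⟨LinearMap.toSpanSingleton (locallyScalar E) E e, fun r hr => ?_⟩
  rw [LinearMap.toSpanSingleton_apply]
  change (r : Module.End ℝ E) e = _
  refine eq_of_forall_exists_isBandProjection hE fun P hP hP0 => ?_
  obtain ⟨Q, hQ, hQ0, hPQ, c, hc⟩ := r.2.2 P hP hP0
  have hmul : ∀ (s j : locallyScalar E) (hj : j ∈ I),
      (s : Module.End ℝ E) (t ⟨j, hj⟩) = t ⟨s * j, I.mul_mem_left s hj⟩ :=
    fun s j hj => (t.map_smul s ⟨j, hj⟩).symm
  by_cases hc0 : c = 0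
  · refine ⟨Q, hQ, hQ0, hPQ, ?_⟩
    have h0 : (⟨_, I.mul_mem_left ⟨Q, hQ.mem_locallyScalar⟩ hr⟩ : I) = 0 := by
      refine Subtype.ext (Subtype.ext (LinearMap.ext fun x => ?_))
      change Q ((r : Module.End ℝ E) x) = 0
      rw [← r.2.1 Q hQ, hc, hc0, zero_smul]
    rw [← r.2.1 Q hQ, hc, hc0, zero_smul]
    refine Eq.symm ((hmul ⟨Q, hQ.mem_locallyScalar⟩ r hr).trans ?_)
    rw [h0, map_zero]
  · have hQI : (⟨Q, hQ.mem_locallyScalar⟩ : locallyScalar E) ∈ I := by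
      convert I.mul_mem_left (c⁻¹ • ⟨Q, hQ.mem_locallyScalar⟩ : locallyScalar E) hr using 1
      refine Subtype.ext (LinearMap.ext fun x => ?_)
      change Q x = c⁻¹ • Q ((r : Module.End ℝ E) x)
      rw [← r.2.1 Q hQ, hc, smul_smul, inv_mul_cancel₀ hc0, one_smul]
    obtain ⟨Q', hQ'F, hQQ'⟩ := hF Q ⟨hQ, hQI⟩ hQ0
    have hQ' := (hFS hQ'F).1
    have hQ1 := hQ.mul hQ'
    refine ⟨Q * Q', hQ1, hQQ', by rw [← mul_assoc, hPQ], ?_⟩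
    have h1 : (⟨_, I.mul_mem_left ⟨Q * Q', hQ1.mem_locallyScalar⟩ hr⟩ : I) =
        ⟨_, I.mul_mem_left (c • ⟨Q, hQ.mem_locallyScalar⟩) (hFI ⟨Q', hQ'F⟩)⟩ := by
      refine Subtype.ext (Subtype.ext (LinearMap.ext fun x => ?_))
      change (Q * Q') ((r : Module.End ℝ E) x) = c • Q (Q' x)
      rw [← r.2.1 _ hQ1, Module.End.mul_apply, hc]
    have h2 := (hmul ⟨Q * Q', hQ1.mem_locallyScalar⟩ r hr).trans (congrArg t h1)
    rw [← hmul _ _ (hFI ⟨Q', hQ'F⟩), ← he] at h2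
    refine Eq.trans ?_ h2.symm
    change _ = c • Q (Q' e)
    rw [← r.2.1 _ hQ1, Module.End.mul_apply, hc]

/-- If `x` is a scalar multiple of `one` on no nonzero band below that of `S`, then some
band preserving operator vanishes at `one` and agrees with `S one` at `x`. -/
lemma exists_bandPreserving_of_independent [PosSMulMono ℝ E] (hE : DedekindComplete E)
    (hU : DisjointlyBounded E) {S : Module.End ℝ E} (hS : IsBandProjection S) {one x : E}
    (hx : ∀ P : Module.End ℝ E, IsBandProjection P → S * P = P →
      ∀ c : ℝ, P x = c • P one → P = 0) :
    ∃ T : Module.End ℝ E, BandPreserving T ∧ T one = 0 ∧ T x = S one := by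
  let φ : locallyScalar E × locallyScalar E →ₗ[locallyScalar E] E :=
    (LinearMap.toSpanSingleton _ E one).coprod (LinearMap.toSpanSingleton _ E x)
  let ψ : locallyScalar E × locallyScalar E →ₗ[locallyScalar E] E :=
    (LinearMap.toSpanSingleton _ E (S one)) ∘ₗ LinearMap.snd _ _ _
  have hφ : ∀ a b, φ (a, b) = (a : Module.End ℝ E) one + (b : Module.End ℝ E) x := fun a b => rfl
  have hψ : ∀ a b, ψ (a, b) = (b : Module.End ℝ E) (S one) := fun a b => rfl
  have hker : LinearMap.ker φ ≤ LinearMap.ker ψ := by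
    rintro ⟨a, b⟩ hab
    rw [LinearMap.mem_ker, hφ] at hab
    rw [LinearMap.mem_ker, hψ]
    refine eq_of_forall_exists_isBandProjection hE fun P hP hP0 => ?_
    obtain ⟨Q, hQ, hQ0, hPQ, α, hα⟩ := a.2.2 P hP hP0
    obtain ⟨Q', hQ', hQ'0, hQQ', β, hβ⟩ := b.2.2 Q hQ hQ0
    have hPQ' : P * Q' = Q' := by rw [← hQQ', ← mul_assoc, hPQ]
    by_cases hSQ : S * Q' = 0
    · refine ⟨Q', hQ', hQ'0, hPQ', ?_⟩
      rw [map_zero, ← b.2.1 Q' hQ', ← hS.apply_comm hQ', ← Module.End.mul_apply S, hSQ,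
        LinearMap.zero_apply, map_zero]
    by_cases hβ0 : β = 0
    · refine ⟨Q', hQ', hQ'0, hPQ', ?_⟩
      rw [map_zero, ← b.2.1 Q' hQ', hβ, hβ0, zero_smul]
    refine absurd (hx _ (hS.mul hQ') hS.mul_mul_eq (-(β⁻¹ * α)) ?_) hSQ
    have h := congrArg (fun y => S (Q' y)) hab
    simp only [map_add, map_zero] at h
    rw [← a.2.1 Q' hQ', ← b.2.1 Q' hQ', hβ, ← hQQ', Module.End.mul_apply, hα,
      ← Module.End.mul_apply Q, hQQ', map_smul, map_smul, add_comm, add_eq_zero_iff_eq_neg] at h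
    change S (Q' x) = _ • S (Q' one)
    rw [neg_smul, mul_smul, ← smul_neg, ← h, smul_smul, inv_mul_cancel₀ hβ0, one_smul]
  obtain ⟨t, ht⟩ := (baer_locallyScalar hE hU).extension_property
    ((LinearMap.ker φ).liftQ φ le_rfl)
    (LinearMap.ker_eq_bot.1 (Submodule.ker_liftQ_eq_bot _ _ _ le_rfl))
    ((LinearMap.ker φ).liftQ ψ hker)
  have htφ : ∀ p, t (φ p) = ψ p := fun p => LinearMap.congr_fun ht (Submodule.Quotient.mk p)
  refine ⟨{ toFun := t, map_add' := t.map_add,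
            map_smul' := fun c y => t.map_smul (algebraMap ℝ (locallyScalar E) c) y },
    bandPreserving_of_apply_comm hE fun P hP y => t.map_smul ⟨P, hP.mem_locallyScalar⟩ y, ?_, ?_⟩
  · have h := htφ (1, 0)
    rw [hφ, hψ] at h
    simpa using h
  · have h := htφ (0, 1)
    rw [hφ, hψ] at h
    simpa using h

/-- Elements are locally approximated by scalar multiples of a positive element. -/
lemma exists_isBandProjection_abs_sub_le [PosSMulMono ℝ E]
    (hArch : ∀ x y : E, (∀ n : ℕ, n • x ≤ y) → x ≤ 0) (hE : DedekindComplete E) {one x : E}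
    (hone_pos : 0 ≤ one) (hone : ∀ x : E, |x| ⊓ |one| = 0 → x = 0) (hx : 0 ≤ x)
    {ε : ℝ} (hε : 0 < ε)
    {P : Module.End ℝ E} (hP : IsBandProjection P) (hP0 : P ≠ 0) :
    ∃ Q : Module.End ℝ E, IsBandProjection Q ∧ Q ≠ 0 ∧ P * Q = Q ∧
      ∃ c : ℝ, |Q x - c • Q one| ≤ ε • one := by
  classical
  have hex : ∃ n : ℕ, ¬ n • ε • P one ≤ P x := by
    by_contra! h
    have h1 := hArch _ _ h
    have h2 : P one ≤ 0 := by
      have := smul_le_smul_of_nonneg_left h1 (inv_nonneg.2 hε.le)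
      rwa [smul_smul, inv_mul_cancel₀ hε.ne', one_smul, smul_zero] at this
    exact hP0 (hP.eq_zero_of_apply_unit hone (le_antisymm h2 (hP.nonneg hone_pos)))
  obtain ⟨n, hn, hmin⟩ : ∃ n : ℕ, ¬ (n + 1) • ε • P one ≤ P x ∧ n • ε • P one ≤ P x := by
    obtain ⟨n, hn⟩ := Nat.exists_eq_succ_of_ne_zero (n := Nat.find hex) fun h0 => by
      have := Nat.find_spec hex
      rw [h0, zero_smul] at this
      exact this (hP.nonneg hx)
    refine ⟨n, ?_, not_not.1 (Nat.find_min hex (hn ▸ Nat.lt_succ_self n))⟩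
    have := Nat.find_spec hex
    rwa [hn] at this
  set z := (n + 1) • ε • P one - P x with hz
  obtain ⟨Q, hQ, hQz, hQy⟩ := exists_isBandProjection hE z⁺
  have hQzz := IsBandProjection.apply_posPart_eq_of_disjoint hQy hQz
  have hPz : P z = z := by
    simp only [hz, map_sub, map_nsmul, map_smul, hP.apply_apply]
  have hPQz : P (Q z) = Q z := by rw [hP.apply_comm hQ, hPz]
  refine ⟨P * Q, hP.mul hQ, fun h0 => hn ?_, hP.mul_mul_eq, n * ε, ?_⟩
  · rw [← sub_nonpos, ← hz, ← posPart_eq_zero, ← hQzz, ← hPQz, ← Module.End.mul_apply, h0,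
      LinearMap.zero_apply]
  · have hcomm : ∀ y, (P * Q) y = Q (P y) := fun y => hP.apply_comm hQ y
    rw [hcomm, hcomm]
    have h1 := hQ.mono hmin
    have h2 : 0 ≤ Q z := hQzz ▸ posPart_nonneg z
    rw [hz, map_sub, sub_nonneg, succ_nsmul, map_add] at h2
    have h3 : (n * ε) • Q (P one) = Q (n • ε • P one) := by
      rw [map_nsmul, map_smul, mul_smul, Nat.cast_smul_eq_nsmul]
    rw [h3, abs_of_nonneg (sub_nonneg.2 h1), sub_le_iff_le_add']
    refine h2.trans (add_le_add_right ?_ _)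
    rw [map_smul]
    exact smul_le_smul_of_nonneg_left
      ((hQ.le_self (hP.nonneg hone_pos)).trans (hP.le_self hone_pos)) hε.le

lemma BandPreserving.apply_eq_zero_of_orderBounded [PosSMulMono ℝ E]
    (hArch : ∀ x y : E, (∀ n : ℕ, n • x ≤ y) → x ≤ 0) (hE : DedekindComplete E) {one x : E}
    (hone_pos : 0 ≤ one) (hone : ∀ x : E, |x| ⊓ |one| = 0 → x = 0) (hx : 0 ≤ x)
    {T : Module.End ℝ E} (hT : BandPreserving T) (hTb : OrderBounded T) (hT1 : T one = 0) :
    T x = 0 := by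
  obtain ⟨a, b, hab⟩ := hTb (-one) one
  set C := |a| + |b| with hC
  have hTC : ∀ y, |y| ≤ one → |T y| ≤ C := by
    intro y hy
    obtain ⟨h1, h2⟩ := abs_le'.1 hy
    obtain ⟨h3, h4⟩ := hab y (neg_le.1 h2) h1
    refine abs_le'.2 ⟨h4.trans ((le_abs_self b).trans (le_add_of_nonneg_left (abs_nonneg a))),
      (neg_le_neg_iff.2 h3).trans ((neg_le_abs a).trans (le_add_of_nonneg_right (abs_nonneg b)))⟩
  have hC0 : 0 ≤ C := add_nonneg (abs_nonneg a) (abs_nonneg b)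
  have hε : ∀ ε : ℝ, 0 < ε → |T x| ≤ ε • C := by
    intro ε hε
    refine le_of_forall_exists_isBandProjection hE fun P hP hP0 => ?_
    obtain ⟨Q, hQ, hQ0, hPQ, c, hc⟩ :=
      exists_isBandProjection_abs_sub_le hArch hE hone_pos hone hx hε hP hP0
    refine ⟨Q, hQ, hQ0, hPQ, ?_⟩
    have h1 : T (Q x - c • Q one) = Q (T x) := by
      rw [map_sub, map_smul, hT.apply_comm hQ, hT.apply_comm hQ, hT1, map_zero, smul_zero, sub_zero]
    have h2 : |ε⁻¹ • (Q x - c • Q one)| ≤ one := by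
      refine (abs_smul_le_smul_abs _ _).trans ?_
      rw [abs_of_pos (inv_pos.2 hε)]
      have := smul_le_smul_of_nonneg_left hc (inv_nonneg.2 hε.le)
      rwa [smul_smul, inv_mul_cancel₀ hε.ne', one_smul] at this
    have h3 : |Q (T x)| ≤ ε • C := by
      have h4 := hTC _ h2
      rw [map_smul, h1] at h4
      have h5 : Q (T x) = ε • ε⁻¹ • Q (T x) := by
        rw [smul_smul, mul_inv_cancel₀ hε.ne', one_smul]
      rw [h5]
      refine (abs_smul_le_smul_abs _ _).trans ?_
      rw [abs_of_pos hε]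
      exact smul_le_smul_of_nonneg_left h4 hε.le
    have h4 := hQ.mono h3
    rwa [hQ.abs_apply, hQ.apply_apply] at h4
  refine eq_zero_of_abs_nonpos (hArch _ C fun n => ?_)
  rcases Nat.eq_zero_or_pos n with rfl | hn
  · rwa [zero_smul]
  · have hn' : (0 : ℝ) < n := Nat.cast_pos.2 hn
    have := smul_le_smul_of_nonneg_left (hε (n : ℝ)⁻¹ (inv_pos.2 hn')) hn'.le
    rwa [smul_smul, mul_inv_cancel₀ hn'.ne', one_smul, Nat.cast_smul_eq_nsmul] at this

/-- If every band preserving operator is order bounded, then every band contains a smaller band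
on which a given positive element is a scalar multiple of the unit. -/
lemma exists_isBandProjection_apply_eq_smul [PosSMulMono ℝ E]
    (hArch : ∀ x y : E, (∀ n : ℕ, n • x ≤ y) → x ≤ 0) (hE : DedekindComplete E)
    (hU : DisjointlyBounded E) {one x : E}
    (hone_pos : 0 ≤ one) (hone : ∀ x : E, |x| ⊓ |one| = 0 → x = 0) (hx : 0 ≤ x)
    (hT : ∀ T : Module.End ℝ E, BandPreserving T → OrderBounded T)
    {P : Module.End ℝ E} (hP : IsBandProjection P) (hP0 : P ≠ 0) :
    ∃ Q : Module.End ℝ E, IsBandProjection Q ∧ P * Q = Q ∧ Q ≠ 0 ∧ ∃ c : ℝ, Q x = c • Q one := by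
  by_contra! h
  obtain ⟨T, hTb, hT1, hTx⟩ := exists_bandPreserving_of_independent hE hU hP (one := one) (x := x)
    fun Q hQ hPQ c hc => by_contra fun hQ0 => h Q hQ hPQ hQ0 c hc
  rw [hTb.apply_eq_zero_of_orderBounded hArch hE hone_pos hone hx (hT T hTb) hT1] at hTx
  exact hP0 (hP.eq_zero_of_apply_unit hone hTx.symm)

/-- `one` generates `x` by scaling on pairwise disjoint bands. -/
def IsLocallyScalarMultiple {E : Type u} [Lattice E] [AddCommGroup E] [Module ℝ E]
    (one x : E) : Prop :=
  ∃ (ι : Type u) (lam : ι → ℝ) (π : ι → E →ₗ[ℝ] E),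
    (∀ i, 0 ≤ lam i) ∧ (∀ i, IsBandProjection (π i)) ∧
    (Pairwise fun i j => (π i).comp (π j) = 0) ∧
    IsLUB (Set.range fun i => lam i • (π i) one) x

lemma isLocallyScalarMultiple_of_forall_exists {E : Type u} [Lattice E] [AddCommGroup E]
    [Module ℝ E] [AddLeftMono E] [PosSMulMono ℝ E] (hE : DedekindComplete E) {one x : E}
    (hone_pos : 0 ≤ one) (hone : ∀ x : E, |x| ⊓ |one| = 0 → x = 0) (hx : 0 ≤ x)
    (h : ∀ P : Module.End ℝ E, IsBandProjection P → P ≠ 0 → ∃ Q : Module.End ℝ E,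
      IsBandProjection Q ∧ P * Q = Q ∧ Q ≠ 0 ∧ ∃ c : ℝ, Q x = c • Q one) :
    IsLocallyScalarMultiple one x := by
  obtain ⟨F, hFS, hFd, hF⟩ := exists_maximal_disjoint_isBandProjection
    {P : Module.End ℝ E | IsBandProjection P ∧ ∃ c : ℝ, 0 ≤ c ∧ P x = c • P one} fun P hP => hP.1
  choose hFP c hc0 hc using fun P : F => hFS P.2
  refine ⟨F, c, fun P => P, hc0, hFP, fun P Q hPQ => hFd P.2 Q.2 (Subtype.coe_injective.ne hPQ),
    Set.forall_mem_range.2 fun P => ?_, fun u hu => ?_⟩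
  · rw [← hc]
    exact (hFP P).le_self hx
  · refine le_of_forall_exists_isBandProjection hE fun P hP hP0 => ?_
    obtain ⟨Q, hQ, hPQ, hQ0, d, hd⟩ := h P hP hP0
    have hd0 : 0 ≤ d := by
      by_contra! hd0
      refine hQ0 (hQ.eq_zero_of_apply_unit hone (le_antisymm ?_ (hQ.nonneg hone_pos)))
      have h1 := smul_le_smul_of_nonneg_left (hd ▸ hQ.nonneg hx)
        (inv_nonneg.2 (neg_nonneg.2 hd0.le))
      rw [smul_zero, smul_smul, inv_neg, neg_mul, inv_mul_cancel₀ hd0.ne, neg_smul, one_smul] at h1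
      exact neg_nonneg.1 h1
    obtain ⟨Q', hQ'F, hQQ'⟩ := hF Q ⟨hQ, d, hd0, hd⟩ hQ0
    have hQ' : IsBandProjection Q' := hFP ⟨Q', hQ'F⟩
    refine ⟨Q * Q', hQ.mul hQ', hQQ', by rw [← mul_assoc, hPQ], hQ.mono ?_⟩
    have h1 := hQ'.mono (hu ⟨⟨Q', hQ'F⟩, rfl⟩)
    simp only [← hc, hQ'.apply_apply] at h1
    exact h1

/-- Either a member of a disjoint family representing `x` meets `P`, or `P x = 0`. -/
lemma apply_eq_zero_of_isLUB {ι : Type*} {lam : ι → ℝ} {π : ι → Module.End ℝ E} {one x : E}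
    (hx : 0 ≤ x) (hlub : IsLUB (Set.range fun i => lam i • (π i) one) x) {P : Module.End ℝ E}
    (hP : IsBandProjection P) (h : ∀ i, P * π i = 0) : P x = 0 := by
  have h1 : x ≤ x - P x := by
    refine hlub.2 (Set.forall_mem_range.2 fun i => ?_)
    have h2 := hP.compl.mono (hlub.1 ⟨i, rfl⟩)
    have h3 : P (π i one) = 0 := LinearMap.congr_fun (h i) one
    simpa [h3] using h2
  exact le_antisymm (by simpa using h1) (hP.nonneg hx)

lemma apply_eq_smul_of_isLUB [PosSMulMono ℝ E] {ι : Type*} {lam : ι → ℝ} {π : ι → Module.End ℝ E}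
    {one x : E} (hone_pos : 0 ≤ one) (hx : 0 ≤ x) (hlam : ∀ i, 0 ≤ lam i)
    (hπ : ∀ i, IsBandProjection (π i))
    (hππ : Pairwise fun i j => (π i).comp (π j) = 0)
    (hlub : IsLUB (Set.range fun i => lam i • (π i) one) x) (i : ι) :
    π i x = lam i • π i one := by
  have h0 : ∀ i, 0 ≤ lam i • π i one := fun i => smul_nonneg (hlam i) ((hπ i).nonneg hone_pos)
  refine le_antisymm ?_ ?_
  · have h1 : x ≤ lam i • π i one + (x - π i x) := by
      refine hlub.2 (Set.forall_mem_range.2 fun j => ?_)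
      by_cases hij : i = j
      · subst hij
        exact le_add_of_nonneg_right ((hπ i).compl.nonneg hx)
      · refine le_add_of_nonneg_of_le (h0 i) ?_
        have h2 := (hπ i).compl.mono (hlub.1 ⟨j, rfl⟩)
        have h3 : π i (π j one) = 0 := LinearMap.congr_fun (hππ hij) one
        simpa [h3] using h2
    have h2 := (hπ i).mono h1
    rwa [map_add, map_sub, map_smul, (hπ i).apply_apply, (hπ i).apply_apply, sub_self,
      add_zero] at h2
  · have h2 := (hπ i).mono (hlub.1 ⟨i, rfl⟩)
    simpa [(hπ i).apply_apply] using h2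

lemma IsLocallyScalarMultiple.exists_isBandProjection_apply_eq_smul {E : Type u} [Lattice E]
    [AddCommGroup E] [Module ℝ E] [AddLeftMono E] [PosSMulMono ℝ E] {one x : E}
    (h : IsLocallyScalarMultiple one x) (hone_pos : 0 ≤ one) (hx : 0 ≤ x)
    {P : Module.End ℝ E} (hP : IsBandProjection P) (hP0 : P ≠ 0) :
    ∃ Q : Module.End ℝ E, IsBandProjection Q ∧ P * Q = Q ∧ Q ≠ 0 ∧
      ∃ c : ℝ, 0 ≤ c ∧ Q x = c • Q one := by
  obtain ⟨ι, lam, π, hlam, hπ, hππ, hlub⟩ := h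
  by_cases hPπ : ∃ i, P * π i ≠ 0
  · obtain ⟨i, hi⟩ := hPπ
    refine ⟨P * π i, hP.mul (hπ i), hP.mul_mul_eq, hi, lam i, hlam i, ?_⟩
    change P (π i x) = lam i • P (π i one)
    rw [apply_eq_smul_of_isLUB hone_pos hx hlam hπ hππ hlub, map_smul]
  · push Not at hPπ
    refine ⟨P, hP, hP.1, hP0, 0, le_rfl, ?_⟩
    rw [zero_smul, apply_eq_zero_of_isLUB hx hlub hP hPπ]

/-- On the interval below `b`, a band preserving operator is bounded by the image of the unit
scaled like `b`. -/
lemma BandPreserving.exists_abs_apply_le {E : Type u} [Lattice E]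
    [AddCommGroup E] [Module ℝ E] [AddLeftMono E] [PosSMulMono ℝ E] (hE : DedekindComplete E)
    (hU : DisjointlyBounded E) {one b : E} (hone_pos : 0 ≤ one)
    (hone : ∀ x : E, |x| ⊓ |one| = 0 → x = 0)
    (h : ∀ x : E, 0 ≤ x → IsLocallyScalarMultiple one x) {T : Module.End ℝ E}
    (hT : BandPreserving T) (hb : 0 ≤ b) :
    ∃ C, ∀ x, 0 ≤ x → x ≤ b → |T x| ≤ C := by
  obtain ⟨ι, lam, π, hlam, hπ, hππ, hlub⟩ := h b hb
  obtain ⟨C, hC⟩ := exists_glue hE hU (P := π) hπ hππ (x := fun i => lam i • π i |T one|)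
    fun i => by rw [map_smul, (hπ i).apply_apply]
  refine ⟨|C|, fun x hx hxb => le_of_forall_exists_isBandProjection hE fun P hP hP0 => ?_⟩
  by_cases hPπ : ∃ i, P * π i ≠ 0
  · obtain ⟨i, hi⟩ := hPπ
    obtain ⟨Q, hQ, hPQ, hQ0, c, hc0, hc⟩ :=
      (h x hx).exists_isBandProjection_apply_eq_smul hone_pos hx (hP.mul (hπ i)) hi
    have hQi : ∀ y, Q (π i y) = Q y := fun y => by
      rw [hQ.apply_comm (hπ i), ← hPQ]
      change π i (P (π i (Q y))) = P (π i (Q y))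
      rw [(hπ i).apply_comm hP, (hπ i).apply_apply]
    have hcl : c ≤ lam i := by
      by_contra! hlt
      refine hQ0 (hQ.eq_zero_of_apply_unit hone (le_antisymm ?_ (hQ.nonneg hone_pos)))
      have h1 := hQ.mono hxb
      rw [hc, ← hQi b, apply_eq_smul_of_isLUB hone_pos hb hlam hπ hππ hlub, map_smul, hQi,
        ← sub_nonpos, ← sub_smul] at h1
      have h2 := smul_le_smul_of_nonneg_left h1 (inv_nonneg.2 (sub_nonneg.2 hlt.le))
      rwa [smul_zero, smul_smul, inv_mul_cancel₀ (sub_pos.2 hlt).ne', one_smul] at h2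
    refine ⟨Q, hQ, hQ0, by rw [← hPQ, ← mul_assoc, hP.mul_mul_eq], ?_⟩
    calc Q |T x| = |c • Q (T one)| := by
          rw [← hQ.abs_apply, ← hT.apply_comm hQ, hc, map_smul, hT.apply_comm hQ]
      _ ≤ |c| • Q |T one| := by
          rw [← hQ.abs_apply]
          exact abs_smul_le_smul_abs _ _
      _ ≤ lam i • Q |T one| := by
          rw [abs_of_nonneg hc0, ← sub_nonneg, ← sub_smul]
          exact smul_nonneg (sub_nonneg.2 hcl) (hQ.nonneg (abs_nonneg _))
      _ = Q C := by rw [← hQi C, hC, map_smul, hQi]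
      _ ≤ Q |C| := hQ.mono (le_abs_self C)
  · push Not at hPπ
    have hPb := apply_eq_zero_of_isLUB hb hlub hP hPπ
    have hPx : P x = 0 := le_antisymm ((hP.mono hxb).trans hPb.le) (hP.nonneg hx)
    refine ⟨P, hP, hP0, hP.1, ?_⟩
    rw [← hP.abs_apply, ← hT.apply_comm hP, hPx, map_zero, abs_zero]
    exact hP.nonneg (abs_nonneg C)

lemma BandPreserving.orderBounded_of_isLocallyScalarMultiple {E : Type u} [Lattice E]
    [AddCommGroup E] [Module ℝ E] [AddLeftMono E] [PosSMulMono ℝ E] (hE : DedekindComplete E)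
    (hU : DisjointlyBounded E) {one : E} (hone_pos : 0 ≤ one)
    (hone : ∀ x : E, |x| ⊓ |one| = 0 → x = 0)
    (h : ∀ x : E, 0 ≤ x → IsLocallyScalarMultiple one x) {T : Module.End ℝ E}
    (hT : BandPreserving T) : OrderBounded T := by
  intro a b
  obtain ⟨C, hC⟩ := hT.exists_abs_apply_le hE hU hone_pos hone h (posPart_nonneg (b - a))
  refine ⟨T a - C, T a + C, fun x hax hxb => ?_⟩
  obtain ⟨h1, h2⟩ := abs_le'.1 (hC (x - a) (sub_nonneg.2 hax)
    ((sub_le_sub_right hxb a).trans (le_posPart _)))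
  rw [map_sub] at h1 h2
  exact ⟨by rwa [neg_sub, sub_le_comm] at h2, by rwa [sub_le_iff_le_add'] at h1⟩

end VectorLattice

theorem bandPreserving_orderBounded_iff_locallyOneDimensional
    [Lattice E] [AddCommGroup E] [Module ℝ E]
    [CovariantClass E E (· + ·) (· ≤ ·)] [PosSMulMono ℝ E]
    (hArch : ∀ x y : E, (∀ n : ℕ, n • x ≤ y) → x ≤ 0)
    (hDedekind : ∀ A : Set E, A.Nonempty → BddAbove A → ∃ s : E, IsLUB A s)
    (hUnivComplete : ∀ A : Set E, (∀ x ∈ A, 0 ≤ x) →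
      (A.Pairwise fun x y => |x| ⊓ |y| = 0) → BddAbove A)
    (one : E) (hone_pos : 0 ≤ one)
    (hone_unit : ∀ x : E, |x| ⊓ |one| = 0 → x = 0) :
    (∀ T : E →ₗ[ℝ] E, BandPreserving T → OrderBounded T) ↔
    (∀ g : E, 0 ≤ g → ∃ (ι : Type u) (lam : ι → ℝ) (π : ι → E →ₗ[ℝ] E),
        (∀ i, 0 ≤ lam i) ∧ (∀ i, IsBandProjection (π i)) ∧
        (Pairwise fun i j => (π i).comp (π j) = 0) ∧
        IsLUB (Set.range fun i => lam i • (π i) one) g) := by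
  constructor
  · intro hT g hg
    exact isLocallyScalarMultiple_of_forall_exists hDedekind hone_pos hone_unit hg
      fun P hP hP0 => exists_isBandProjection_apply_eq_smul hArch hDedekind hUnivComplete hone_pos
        hone_unit hg hT hP hP0
  · intro h T hT
    exact hT.orderBounded_of_isLocallyScalarMultiple hDedekind hUnivComplete hone_pos hone_unit h
end

section
/- Let ℙ be an algebraically closed subfield of the complex field ℂ that is topologically dense in ℂ. Then the following are equivalent: (1) ℙ = ℂ; (2) every ℙ-linear map f : ℂ → ℂ is order bounded, i.e. maps bounded subsets of ℂ to bounded subsets of ℂ; (3) there is no nonzero ℙ-derivation on ℂ; (4) every ℙ-linear ring endomorphism of ℂ is either the zero map or the identity; (5) the identity is the only ℙ-linear ring automorphism of ℂ. -/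
/-! Statement 4: For an algebraically closed, topologically dense subfield `ℙ` of `ℂ`, the
conditions (1)–(5) of Theorem 5.6 are equivalent. -/

/-- `f : ℂ → ℂ` is `ℙ`-linear: additive and `ℙ`-homogeneous. -/
def PLinear (P : Subfield ℂ) (f : ℂ → ℂ) : Prop :=
  (∀ x y : ℂ, f (x + y) = f x + f y) ∧ ∀ p ∈ P, ∀ x : ℂ, f (p * x) = p * f x

open MvPolynomial KaehlerDifferential

section TranscendenceBasis

variable {K L ι : Type*} [Field K] [Field L] [Algebra K L] {x : ι → L}

/-- A field of characteristic zero that is algebraic over a subring is formally étale over it. -/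
theorem Algebra.FormallyEtale.of_isAlgebraic_of_charZero (S L : Type*) [CommRing S] [IsDomain S]
    [Field L] [CharZero L] [Algebra S L] [FaithfulSMul S L] [Algebra.IsAlgebraic S L] :
    Algebra.FormallyEtale S L := by
  let _ : Algebra (FractionRing S) L := FractionRing.liftAlgebra S L
  have _ : IsScalarTower S (FractionRing S) L := FractionRing.isScalarTower_liftAlgebra S L
  have _ : CharZero (FractionRing S) :=
    (algebraMap (FractionRing S) L).charZero_iff (algebraMap (FractionRing S) L).injective |>.2 ‹_›
  have _ : Algebra.IsAlgebraic (FractionRing S) L :=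
    IsFractionRing.comap_isAlgebraic_iff.1 ‹Algebra.IsAlgebraic S L›
  have _ : Algebra.FormallyEtale S (FractionRing S) := .of_isLocalization (nonZeroDivisors S)
  have _ : Algebra.FormallyEtale (FractionRing S) L := .of_isSeparable _ _
  exact .comp S (FractionRing S) L

/-- The field is algebraic over the polynomial ring on a transcendence basis. -/
theorem IsTranscendenceBasis.isAlgebraic_mvPolynomial (hx : IsTranscendenceBasis K x)
    [Algebra (MvPolynomial ι K) L]
    (h : algebraMap (MvPolynomial ι K) L = (aeval x : MvPolynomial ι K →ₐ[K] L)) :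
    Algebra.IsAlgebraic (MvPolynomial ι K) L := by
  have := hx.isAlgebraic
  refine Algebra.IsAlgebraic.of_ringHom_of_comp_eq
    (hx.1.aevalEquiv : MvPolynomial ι K →+* Algebra.adjoin K (Set.range x)) (RingHom.id L)
    hx.1.aevalEquiv.surjective Function.injective_id ?_
  ext p <;> simp [h]

/-- In characteristic zero, a derivation may be prescribed freely on a transcendence basis. -/
theorem IsTranscendenceBasis.exists_derivation [CharZero L] (hx : IsTranscendenceBasis K x)
    (v : ι → L) : ∃ d : Derivation K L L, ∀ i, d (x i) = v i := by
  let _ : Algebra (MvPolynomial ι K) L := (aeval x : MvPolynomial ι K →ₐ[K] L).toAlgebra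
  have _ : IsScalarTower K (MvPolynomial ι K) L :=
    .of_algebraMap_eq fun a => ((aeval x : MvPolynomial ι K →ₐ[K] L).commutes a).symm
  have _ : FaithfulSMul (MvPolynomial ι K) L :=
    (faithfulSMul_iff_algebraMap_injective _ _).2 hx.1
  have _ := hx.isAlgebraic_mvPolynomial rfl
  have _ := Algebra.FormallyEtale.of_isAlgebraic_of_charZero (MvPolynomial ι K) L
  let e := tensorKaehlerEquivOfFormallyEtale K (MvPolynomial ι K) L
  let l := (mkDerivation K v : Derivation K (MvPolynomial ι K) L).liftKaehlerDifferential
  refine ⟨((l.liftBaseChange L).comp e.symm.toLinearMap).compDer (D K L), fun i => ?_⟩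
  have hi : x i = algebraMap (MvPolynomial ι K) L (X i) := (aeval_X x i).symm
  simp [hi, e, l, tensorKaehlerEquivOfFormallyEtale_symm_D_algebraMap]

/-- An algebraically closed field of characteristic zero that is transcendental over a subfield
has a nontrivial automorphism over that subfield. -/
theorem IsTranscendenceBasis.exists_algEquiv_ne_refl [CharZero L] [IsAlgClosed L] [Nonempty ι]
    (hx : IsTranscendenceBasis K x) : ∃ σ : L ≃ₐ[K] L, σ ≠ AlgEquiv.refl := by
  let S := MvPolynomial ι K
  let F := FractionRing S
  let _ : Algebra S L := (aeval x : S →ₐ[K] L).toAlgebra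
  have _ : IsScalarTower K S L :=
    .of_algebraMap_eq fun a => ((aeval x : S →ₐ[K] L).commutes a).symm
  have _ : FaithfulSMul S L := (faithfulSMul_iff_algebraMap_injective _ _).2 hx.1
  have _ : Algebra.IsAlgebraic S L := hx.isAlgebraic_mvPolynomial rfl
  let _ : Algebra F L := FractionRing.liftAlgebra S L
  have _ : IsScalarTower S F L := FractionRing.isScalarTower_liftAlgebra S L
  have _ : IsScalarTower K F L := .to₁₃₄ K S F L
  have _ : CharZero F := (algebraMap F L).charZero_iff (algebraMap F L).injective |>.2 ‹_›
  have _ : Algebra.IsAlgebraic F L :=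
    IsFractionRing.comap_isAlgebraic_iff.1 ‹Algebra.IsAlgebraic S L›
  have _ : IsAlgClosure F L := ⟨‹_›, ‹_›⟩
  have _ : Normal F L := IsAlgClosure.normal F L
  have _ : IsGalois F L := {}
  by_contra! h
  obtain ⟨i⟩ := ‹Nonempty ι›
  obtain ⟨r, hr⟩ := IsAlgClosed.exists_pow_nat_eq (x i) two_pos
  obtain ⟨s, rfl⟩ := (InfiniteGalois.mem_range_algebraMap_iff_fixed r).2 fun σ : L ≃ₐ[F] L =>
    DFunLike.congr_fun (h (σ.restrictScalars K)) r
  have hs : s ^ 2 = algebraMap S F (X i) := by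
    apply (algebraMap F L).injective
    rw [map_pow, hr, ← IsScalarTower.algebraMap_apply]
    exact (aeval_X x i).symm
  obtain ⟨p, rfl⟩ := IsIntegrallyClosed.exists_algebraMap_eq_of_isIntegral_pow (R := S) two_pos
    (hs ▸ isIntegral_algebraMap)
  rw [← map_pow] at hs
  exact (X_prime (i := i)).irreducible.not_isSquare
    ⟨p, by rw [← sq]; exact (IsFractionRing.injective S F hs).symm⟩

end TranscendenceBasis

/-- A proper algebraically closed subfield admits a nonempty transcendence basis. -/
theorem Subfield.exists_isTranscendenceBasis_of_ne_top {L : Type*} [Field L] (P : Subfield L)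
    [IsAlgClosed P] (hP : P ≠ ⊤) :
    ∃ s : Set L, Nonempty s ∧ IsTranscendenceBasis P ((↑) : s → L) := by
  obtain ⟨s, hs⟩ := exists_isTranscendenceBasis P L
  refine ⟨s, ?_, hs⟩
  by_contra hempty
  rw [not_nonempty_iff, hs.isEmpty_iff_isAlgebraic] at hempty
  refine hP (eq_top_iff.2 fun z _ => ?_)
  obtain ⟨p, rfl⟩ := (IsAlgClosed.algebraMap_bijective_of_isIntegral (k := P) (K := L)).2 z
  exact p.2

theorem PLinear.eq_mul_of_eq_top {P : Subfield ℂ} (hP : P = ⊤) {f : ℂ → ℂ} (hf : PLinear P f)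
    (x : ℂ) : f x = x * f 1 := by
  simpa using hf.2 x (hP ▸ Subfield.mem_top x) 1

theorem LinearMap.pLinear {P : Subfield ℂ} (f : ℂ →ₗ[P] ℂ) : PLinear P f :=
  ⟨map_add f, fun p hp x => map_smul f ⟨p, hp⟩ x⟩

/-- Over a proper dense subfield, some linear map is unbounded on the closed unit ball. -/
theorem exists_pLinear_not_isBounded {P : Subfield ℂ} (hdense : Dense (P : Set ℂ)) (hP : P ≠ ⊤) :
    ∃ f : ℂ → ℂ, PLinear P f ∧ ¬ Bornology.IsBounded (f '' Metric.closedBall 0 1) := by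
  obtain ⟨x, -, hx⟩ := SetLike.exists_of_lt hP.lt_top
  have hx' : x ∉ Submodule.span P {(1 : ℂ)} := by
    rw [Submodule.mem_span_singleton]
    rintro ⟨p, rfl⟩
    exact hx (by simp [Subfield.smul_def])
  obtain ⟨g, hgx, hg⟩ := Submodule.exists_dual_map_eq_bot_of_notMem hx' inferInstance
  have hg1 : g 1 = 0 := by
    have : g 1 ∈ (Submodule.span P {(1 : ℂ)}).map g :=
      Submodule.mem_map_of_mem (Submodule.mem_span_singleton_self 1)
    simpa [hg] using this
  let f : ℂ →ₗ[P] ℂ := (Algebra.linearMap P ℂ).comp ((g x)⁻¹ • g)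
  have hfx : f x = 1 := by simp [f, hgx]
  have hf1 : f 1 = 0 := by simp [f, hg1]
  refine ⟨f, f.pLinear, fun hb => ?_⟩
  obtain ⟨M, hM⟩ := hb.exists_norm_le
  obtain ⟨n, hn⟩ := exists_nat_gt (max M 0)
  have hn0 : (0 : ℝ) < n := (le_max_right _ _).trans_lt hn
  obtain ⟨p, hp, hxp⟩ := hdense.exists_dist_lt x (inv_pos.2 hn0)
  have hfp : f p = 0 := by simpa [hf1] using f.pLinear.2 p hp 1
  have hfn : f (n * (x - p)) = n := by
    rw [f.pLinear.2 n (natCast_mem P n), map_sub, hfx, hfp, sub_zero, mul_one]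
  have hmem : (n : ℂ) * (x - p) ∈ Metric.closedBall (0 : ℂ) 1 := by
    rw [mem_closedBall_zero_iff, norm_mul, Complex.norm_natCast, ← dist_eq_norm,
      ← mul_inv_cancel₀ hn0.ne']
    gcongr
  have := hM _ (Set.mem_image_of_mem f hmem)
  rw [hfn, Complex.norm_natCast] at this
  exact absurd this (not_le.2 ((le_max_left _ _).trans_lt hn))

theorem exists_pLinear_derivation_ne_zero {P : Subfield ℂ} [IsAlgClosed P] (hP : P ≠ ⊤) :
    ∃ d : ℂ → ℂ, PLinear P d ∧ (∀ x y : ℂ, d (x * y) = d x * y + x * d y) ∧ d ≠ 0 := by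
  obtain ⟨s, ⟨i⟩, hs⟩ := P.exists_isTranscendenceBasis_of_ne_top hP
  obtain ⟨d, hd⟩ := hs.exists_derivation fun _ => 1
  refine ⟨d, d.toLinearMap.pLinear, fun x y => ?_, fun h => ?_⟩
  · rw [d.leibniz, smul_eq_mul, smul_eq_mul]
    ring
  · simpa [h] using hd i

theorem exists_pLinear_automorphism_ne_id {P : Subfield ℂ} [IsAlgClosed P] (hP : P ≠ ⊤) :
    ∃ τ : ℂ → ℂ, PLinear P τ ∧ (∀ x y : ℂ, τ (x * y) = τ x * τ y) ∧ Function.Bijective τ ∧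
      τ ≠ id := by
  obtain ⟨s, _, hs⟩ := P.exists_isTranscendenceBasis_of_ne_top hP
  obtain ⟨σ, hσ⟩ := hs.exists_algEquiv_ne_refl
  exact ⟨σ, σ.toLinearMap.pLinear, map_mul σ, σ.bijective,
    fun h => hσ (AlgEquiv.ext fun z => congrFun h z)⟩

theorem algClosed_dense_subfield_tfae (P : Subfield ℂ) [IsAlgClosed P]
    (hdense : Dense (P : Set ℂ)) :
    ((P = ⊤) ↔ ∀ f : ℂ → ℂ, PLinear P f →
        ∀ B : Set ℂ, Bornology.IsBounded B → Bornology.IsBounded (f '' B)) ∧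
    ((P = ⊤) ↔ ∀ d : ℂ → ℂ, PLinear P d →
        (∀ x y : ℂ, d (x * y) = d x * y + x * d y) → d = 0) ∧
    ((P = ⊤) ↔ ∀ τ : ℂ → ℂ, PLinear P τ →
        (∀ x y : ℂ, τ (x * y) = τ x * τ y) → τ = 0 ∨ τ = id) ∧
    ((P = ⊤) ↔ ∀ τ : ℂ → ℂ, PLinear P τ →
        (∀ x y : ℂ, τ (x * y) = τ x * τ y) → Function.Bijective τ → τ = id) := by
  have eq_zero_or_id (hP : P = ⊤) (τ : ℂ → ℂ) (hτ : PLinear P τ)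
      (hmul : ∀ x y : ℂ, τ (x * y) = τ x * τ y) : τ = 0 ∨ τ = id := by
    have h1 : τ 1 = τ 1 * τ 1 := by simpa using hmul 1 1
    rcases eq_or_ne (τ 1) 0 with h | h
    · exact .inl (funext fun x => by simp [hτ.eq_mul_of_eq_top hP x, h])
    · have h1 : τ 1 = 1 := by simpa [h] using h1
      exact .inr (funext fun x => by simp [hτ.eq_mul_of_eq_top hP x, h1])
  refine ⟨⟨fun hP f hf B hB => ?_, fun h => ?_⟩, ⟨fun hP d hd hmul => ?_, fun h => ?_⟩,
    ⟨eq_zero_or_id, fun h => ?_⟩,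
    ⟨fun hP τ hτ hmul hbij => (eq_zero_or_id hP τ hτ hmul).resolve_left ?_, fun h => ?_⟩⟩
  · obtain ⟨M, hM⟩ := hB.exists_norm_le
    refine isBounded_iff_forall_norm_le.2 ⟨M * ‖f 1‖, ?_⟩
    rintro _ ⟨x, hx, rfl⟩
    rw [hf.eq_mul_of_eq_top hP, norm_mul]
    gcongr
    exact hM x hx
  · by_contra hP
    obtain ⟨f, hf, hb⟩ := exists_pLinear_not_isBounded hdense hP
    exact hb (h f hf _ Metric.isBounded_closedBall)
  · have h1 : d 1 = 0 := by simpa using hmul 1 1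
    exact funext fun x => by simp [hd.eq_mul_of_eq_top hP x, h1]
  · by_contra hP
    obtain ⟨d, hd, hmul, hne⟩ := exists_pLinear_derivation_ne_zero hP
    exact hne (h d hd hmul)
  · by_contra hP
    obtain ⟨τ, hτ, hmul, hbij, hne⟩ := exists_pLinear_automorphism_ne_id hP
    rcases h τ hτ hmul with rfl | h
    · exact zero_ne_one (hbij.1 rfl : (0 : ℂ) = 1)
    · exact hne h
  · rintro rfl
    exact zero_ne_one (hbij.1 rfl : (0 : ℂ) = 1)
  · by_contra hP
    obtain ⟨τ, hτ, hmul, hbij, hne⟩ := exists_pLinear_automorphism_ne_id hP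
    exact hne (h τ hτ hmul hbij)
end

section
/- Let H₁, …, H_N be cones in a vector lattice E and let f and g be positive linear functionals on E. Then the inequality f(h₁ ∨ … ∨ h_N) ≥ g(h₁ ∨ … ∨ h_N) holds for all h_k ∈ H_k (k = 1, …, N) if and only if for every decomposition of g into a sum of N positive linear functionals, g = g₁ + … + g_N, there is a decomposition of f into a sum of N positive linear functionals, f = f₁ + … + f_N, such that f_k(h_k) ≥ g_k(h_k) for all h_k ∈ H_k and k = 1, …, N. -/
/-! Statement 8 (Decomposition Theorem): For cones `H 1, …, H N` in a vector lattice `E` and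
positive functionals `f, g`, one has `f(h₁ ∨ … ∨ h_N) ≥ g(h₁ ∨ … ∨ h_N)` for all `h_k ∈ H k`
iff every decomposition of `g` into `N` positive summands admits a matching decomposition
of `f`. -/

universe u

variable {E : Type u}

/-- A cone in `E`: nonempty, closed under addition and multiplication by nonnegative reals. -/
def IsCone [Lattice E] [AddCommGroup E] [Module ℝ E] (H : Set E) : Prop :=
  H.Nonempty ∧ (∀ x ∈ H, ∀ y ∈ H, x + y ∈ H) ∧ ∀ c : ℝ, 0 ≤ c → ∀ x ∈ H, c • x ∈ H

/-- A positive linear functional. -/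
def PositiveFunctional [Lattice E] [AddCommGroup E] [Module ℝ E] (f : E →ₗ[ℝ] ℝ) : Prop :=
  ∀ x : E, 0 ≤ x → 0 ≤ f x

/-- **Mazur–Orlicz theorem** on a cone: a superlinear function dominated by a sublinear one on a
cone can be separated from it by a linear functional. -/
theorem exists_linearMap_between_of_cone {V : Type*} [AddCommGroup V] [Module ℝ V]
    (p G : V → ℝ) (p_hom : ∀ c : ℝ, 0 < c → ∀ x, p (c • x) = c * p x)
    (p_add : ∀ x y, p (x + y) ≤ p x + p y)
    (C : Set V) (zero_mem : 0 ∈ C) (add_mem : ∀ x ∈ C, ∀ y ∈ C, x + y ∈ C)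
    (smul_mem : ∀ c : ℝ, 0 < c → ∀ x ∈ C, c • x ∈ C)
    (G_zero : G 0 = 0) (G_add : ∀ x ∈ C, ∀ y ∈ C, G x + G y ≤ G (x + y))
    (G_hom : ∀ c : ℝ, 0 < c → ∀ x ∈ C, c * G x ≤ G (c • x))
    (hGp : ∀ x ∈ C, G x ≤ p x) :
    ∃ L : V →ₗ[ℝ] ℝ, (∀ x, L x ≤ p x) ∧ ∀ x ∈ C, G x ≤ L x := by
  have p_zero : p 0 = 0 := by
    have := p_hom 2 two_pos 0
    rw [smul_zero] at this
    linarith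
  let q : V → ℝ := fun x => ⨅ c : C, (p (x + c) - G c)
  have : Nonempty C := ⟨⟨0, zero_mem⟩⟩
  have bdd (x : V) : BddBelow (Set.range fun c : C => p (x + c) - G c) := by
    refine ⟨-p (-x), ?_⟩
    rintro _ ⟨c, rfl⟩
    have h1 := p_add (x + c) (-x)
    have h2 := hGp c c.2
    rw [show x + (c : V) + -x = c by abel] at h1
    dsimp only
    linarith
  have q_le (x : V) {c : V} (hc : c ∈ C) : q x ≤ p (x + c) - G c := ciInf_le (bdd x) ⟨c, hc⟩
  have q_hom_le (c : ℝ) (hc : 0 < c) (x : V) : q (c • x) ≤ c * q x := by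
    rw [← div_le_iff₀' hc]
    refine le_ciInf fun d => ?_
    rw [div_le_iff₀' hc]
    have h1 := q_le (c • x) (smul_mem c hc d d.2)
    have h2 := G_hom c hc d d.2
    rw [← smul_add, p_hom c hc] at h1
    linarith
  have q_hom (c : ℝ) (hc : 0 < c) (x : V) : q (c • x) = c * q x := by
    refine le_antisymm (q_hom_le c hc x) ?_
    have h := q_hom_le c⁻¹ (inv_pos.2 hc) (c • x)
    rwa [inv_smul_smul₀ hc.ne', le_inv_mul_iff₀ hc] at h
  have q_add (x y : V) : q (x + y) ≤ q x + q y := by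
    refine le_ciInf_add_ciInf fun c d => ?_
    have h1 := q_le (x + y) (add_mem c c.2 d d.2)
    have h2 := G_add c c.2 d d.2
    have h3 := p_add (x + c) (y + d)
    rw [show x + (c : V) + (y + d) = x + y + (c + d) by abel] at h3
    linarith
  have q_zero : 0 ≤ q 0 := by
    refine le_ciInf fun c => ?_
    have := hGp c c.2
    rw [zero_add]
    linarith
  obtain ⟨L, -, hL⟩ := exists_extension_of_le_sublinear (⊥ : V →ₗ.[ℝ] ℝ) q q_hom q_add (by
    rintro ⟨x, hx⟩
    obtain rfl : x = 0 := (Submodule.mem_bot ℝ).1 hx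
    exact (LinearPMap.map_zero _).trans_le q_zero)
  refine ⟨L, fun x => ?_, fun x hx => ?_⟩
  · have h := q_le x zero_mem
    rw [add_zero, G_zero, sub_zero] at h
    exact (hL x).trans h
  · have h := (hL (-x)).trans (q_le (-x) hx)
    rw [neg_add_cancel, p_zero, map_neg] at h
    linarith

section FinsetSup

variable [Lattice E] [AddCommGroup E]
  {ι : Type*} {s : Finset ι} (hs : s.Nonempty)

theorem Finset.sup'_add_le_add_sup' [CovariantClass E E (· + ·) (· ≤ ·)] (x y : ι → E) :
    s.sup' hs (x + y) ≤ s.sup' hs x + s.sup' hs y := by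
  have : IsOrderedAddMonoid E :=
    ⟨fun a b h c => by
      rw [add_comm a, add_comm b]
      exact CovariantClass.elim c h,
      fun a b h c => CovariantClass.elim c h⟩
  exact Finset.sup'_le _ _ fun i hi => add_le_add (Finset.le_sup' x hi) (Finset.le_sup' y hi)

theorem Finset.sup'_smul_of_pos [Module ℝ E] [PosSMulMono ℝ E] {c : ℝ} (hc : 0 < c) (x : ι → E) :
    s.sup' hs (c • x) = c • s.sup' hs x := by
  have key (c : ℝ) (hc : 0 < c) (x : ι → E) : s.sup' hs (c • x) ≤ c • s.sup' hs x :=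
    Finset.sup'_le _ _ fun i hi => smul_le_smul_of_nonneg_left (Finset.le_sup' x hi) hc.le
  refine le_antisymm (key c hc x) ?_
  have h := smul_le_smul_of_nonneg_left (key c⁻¹ (inv_pos.2 hc) (c • x)) hc.le
  rwa [inv_smul_smul₀ hc.ne', smul_inv_smul₀ hc.ne'] at h

end FinsetSup

section PositiveFunctional

variable [Lattice E] [AddCommGroup E] [Module ℝ E] [CovariantClass E E (· + ·) (· ≤ ·)]

theorem PositiveFunctional.monotone {f : E →ₗ[ℝ] ℝ} (hf : PositiveFunctional f) :
    Monotone f := fun x y h => by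
  have h1 : -x + x ≤ -x + y := CovariantClass.elim (-x) h
  rw [neg_add_cancel] at h1
  have h2 := hf _ h1
  rw [map_add, map_neg] at h2
  linarith

variable {ι : Type*} [Fintype ι] (hι : (Finset.univ : Finset ι).Nonempty)

theorem PositiveFunctional.sum_apply_le_sup' {fs : ι → (E →ₗ[ℝ] ℝ)}
    (hfs : ∀ i, PositiveFunctional (fs i)) (x : ι → E) :
    ∑ i, fs i (x i) ≤ (∑ i, fs i) (Finset.univ.sup' hι x) := by
  rw [LinearMap.sum_apply]
  exact Finset.sum_le_sum fun i hi => (hfs i).monotone (Finset.le_sup' x hi)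

/-- A linear functional on `ι → E` dominated by `x ↦ f (⋁ i, x i)` is given by a decomposition
of `f` into positive functionals. -/
theorem PositiveFunctional.exists_decomposition_of_le_sup' {f : E →ₗ[ℝ] ℝ}
    (hf : PositiveFunctional f) (L : (ι → E) →ₗ[ℝ] ℝ)
    (hL : ∀ x, L x ≤ f (Finset.univ.sup' hι x)) :
    ∃ fs : ι → (E →ₗ[ℝ] ℝ), (∀ i, PositiveFunctional (fs i)) ∧ f = ∑ i, fs i ∧
      ∀ x, L x = ∑ i, fs i (x i) := by
  classical
  have hsum (x : ι → E) : L x = ∑ i, (L ∘ₗ LinearMap.single ℝ (fun _ => E) i) (x i) := by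
    conv_lhs => rw [← Finset.univ_sum_single x, map_sum]
    rfl
  refine ⟨fun i => L ∘ₗ LinearMap.single ℝ (fun _ => E) i, fun i x hx => ?_, ?_, hsum⟩
  · have hneg : -x ≤ 0 := by
      have h : -x + 0 ≤ -x + x := CovariantClass.elim (-x) hx
      simpa using h
    have h1 := hL (Pi.single i (-x))
    have h2 : Finset.univ.sup' hι (Pi.single i (-x)) ≤ 0 := by
      refine Finset.sup'_le _ _ fun j _ => ?_
      rcases eq_or_ne j i with rfl | hj
      · simpa only [Pi.single_eq_same] using hneg
      · rw [Pi.single_eq_of_ne hj]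
    have h3 := hf.monotone h2
    rw [Pi.single_neg, map_neg] at h1
    rw [map_zero] at h3
    change 0 ≤ L (Pi.single i x)
    rw [Pi.single_neg] at h3
    linarith
  · ext x
    rw [LinearMap.sum_apply, ← hsum fun _ => x]
    have h1 := hL fun _ => x
    have h2 := hL (-fun _ => x)
    have h3 : (-fun _ : ι => x) = fun _ => -x := rfl
    rw [map_neg, h3, Finset.sup'_const, map_neg] at h2
    rw [Finset.sup'_const] at h1
    linarith

/-- Given positive `f`, a superlinear function on a cone in `ι → E` dominated by
`x ↦ f (⋁ i, x i)` is dominated by a decomposition of `f` into positive functionals. -/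
theorem PositiveFunctional.exists_decomposition_ge [PosSMulMono ℝ E] {f : E →ₗ[ℝ] ℝ}
    (hf : PositiveFunctional f) (G : (ι → E) → ℝ)
    (C : Set (ι → E)) (zero_mem : 0 ∈ C) (add_mem : ∀ x ∈ C, ∀ y ∈ C, x + y ∈ C)
    (smul_mem : ∀ c : ℝ, 0 < c → ∀ x ∈ C, c • x ∈ C)
    (G_zero : G 0 = 0) (G_add : ∀ x ∈ C, ∀ y ∈ C, G x + G y ≤ G (x + y))
    (G_hom : ∀ c : ℝ, 0 < c → ∀ x ∈ C, c * G x ≤ G (c • x))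
    (hG : ∀ x ∈ C, G x ≤ f (Finset.univ.sup' hι x)) :
    ∃ fs : ι → (E →ₗ[ℝ] ℝ), (∀ i, PositiveFunctional (fs i)) ∧ f = ∑ i, fs i ∧
      ∀ x ∈ C, G x ≤ ∑ i, fs i (x i) := by
  obtain ⟨L, hL, hGL⟩ := exists_linearMap_between_of_cone
    (fun x => f (Finset.univ.sup' hι x)) G
    (fun c hc x => by rw [Finset.sup'_smul_of_pos hι hc, map_smul, smul_eq_mul])
    (fun x y => (hf.monotone (Finset.sup'_add_le_add_sup' hι x y)).trans_eq (map_add f _ _))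
    C zero_mem add_mem smul_mem G_zero G_add G_hom hG
  obtain ⟨fs, hfs, hsum, hfsL⟩ := hf.exists_decomposition_of_le_sup' hι L hL
  exact ⟨fs, hfs, hsum, fun x hx => (hGL x hx).trans_eq (hfsL x)⟩

/-- The value of a positive functional at a finite supremum is attained by a decomposition. -/
theorem PositiveFunctional.exists_decomposition_sup'_le [PosSMulMono ℝ E] {g : E →ₗ[ℝ] ℝ}
    (hg : PositiveFunctional g) (x : ι → E) :
    ∃ gs : ι → (E →ₗ[ℝ] ℝ), (∀ i, PositiveFunctional (gs i)) ∧ g = ∑ i, gs i ∧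
      g (Finset.univ.sup' hι x) ≤ ∑ i, gs i (x i) := by
  have sup_smul (c : ℝ) (hc : 0 ≤ c) :
      g (Finset.univ.sup' hι (c • x)) = c * g (Finset.univ.sup' hι x) := by
    rcases hc.eq_or_lt with rfl | hc
    · rw [zero_smul, zero_mul]
      exact (congrArg g (Finset.sup'_const hι (0 : E))).trans (map_zero g)
    · rw [Finset.sup'_smul_of_pos hι hc, map_smul, smul_eq_mul]
  obtain ⟨gs, hgs, hsum, h⟩ := hg.exists_decomposition_ge hι
    (fun y => g (Finset.univ.sup' hι y)) {y | ∃ c : ℝ, 0 ≤ c ∧ c • x = y}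
    ⟨0, le_rfl, zero_smul _ _⟩
    (by
      rintro _ ⟨c, hc, rfl⟩ _ ⟨d, hd, rfl⟩
      exact ⟨c + d, add_nonneg hc hd, add_smul _ _ _⟩)
    (by
      rintro c hc _ ⟨d, hd, rfl⟩
      exact ⟨c * d, mul_nonneg hc.le hd, mul_smul _ _ _⟩)
    (by simp)
    (by
      rintro _ ⟨c, hc, rfl⟩ _ ⟨d, hd, rfl⟩
      rw [← add_smul, sup_smul c hc, sup_smul d hd, sup_smul _ (add_nonneg hc hd), add_mul])
    (by
      rintro c hc _ ⟨d, hd, rfl⟩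
      rw [smul_smul, sup_smul d hd, sup_smul _ (mul_nonneg hc.le hd), mul_assoc])
    (fun _ _ => le_rfl)
  exact ⟨gs, hgs, hsum, h x ⟨1, zero_le_one, one_smul _ _⟩⟩

end PositiveFunctional

theorem IsCone.zero_mem [Lattice E] [AddCommGroup E] [Module ℝ E] {H : Set E} (hH : IsCone H) :
    0 ∈ H := by
  obtain ⟨x, hx⟩ := hH.1
  simpa using hH.2.2 0 le_rfl x hx

theorem decomposition_theorem
    [Lattice E] [AddCommGroup E] [Module ℝ E]
    [CovariantClass E E (· + ·) (· ≤ ·)] [PosSMulMono ℝ E]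
    (hArch : ∀ x y : E, (∀ n : ℕ, n • x ≤ y) → x ≤ 0)
    (N : ℕ) (hN : 0 < N) (H : Fin N → Set E) (hH : ∀ i, IsCone (H i))
    (f g : E →ₗ[ℝ] ℝ) (hf : PositiveFunctional f) (hg : PositiveFunctional g) :
    (∀ h : Fin N → E, (∀ i, h i ∈ H i) →
        g (Finset.univ.sup' (Finset.univ_nonempty_iff.mpr ⟨⟨0, hN⟩⟩) h) ≤
          f (Finset.univ.sup' (Finset.univ_nonempty_iff.mpr ⟨⟨0, hN⟩⟩) h)) ↔
    (∀ gs : Fin N → (E →ₗ[ℝ] ℝ), (∀ i, PositiveFunctional (gs i)) →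
        g = ∑ i, gs i →
        ∃ fs : Fin N → (E →ₗ[ℝ] ℝ), (∀ i, PositiveFunctional (fs i)) ∧
          f = ∑ i, fs i ∧ ∀ i, ∀ h ∈ H i, gs i h ≤ fs i h) := by
  have hι : (Finset.univ : Finset (Fin N)).Nonempty := Finset.univ_nonempty_iff.mpr ⟨⟨0, hN⟩⟩
  constructor
  · rintro hgf gs hgs rfl
    obtain ⟨fs, hfs, hsum, h⟩ := hf.exists_decomposition_ge hι
      (fun x => ∑ i, gs i (x i)) {x | ∀ i, x i ∈ H i}
      (fun i => (hH i).zero_mem)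
      (fun x hx y hy i => (hH i).2.1 _ (hx i) _ (hy i))
      (fun c hc x hx i => (hH i).2.2 c hc.le _ (hx i))
      (by simp)
      (fun x _ y _ => by simp [Finset.sum_add_distrib])
      (fun c _ x _ => by simp [Finset.mul_sum])
      (fun x hx => (PositiveFunctional.sum_apply_le_sup' hι hgs x).trans (hgf x hx))
    refine ⟨fs, hfs, hsum, fun i x hx => ?_⟩
    have key (k : Fin N → (E →ₗ[ℝ] ℝ)) : ∑ j, k j (Pi.single (M := fun _ => E) i x j) = k i x := by
      rw [Finset.sum_eq_single i (fun j _ hj => by rw [Pi.single_eq_of_ne hj, map_zero])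
        (fun hi => absurd (Finset.mem_univ i) hi), Pi.single_eq_same]
    have h' := h (Pi.single i x) fun j => by
      rcases eq_or_ne j i with rfl | hj
      · rwa [Pi.single_eq_same]
      · rw [Pi.single_eq_of_ne hj]
        exact (hH j).zero_mem
    rwa [key, key] at h'
  · intro hdec x hx
    obtain ⟨gs, hgs, hsum, hle⟩ := hg.exists_decomposition_sup'_le hι x
    obtain ⟨fs, hfs, rfl, hgf⟩ := hdec gs hgs hsum
    exact hle.trans ((Finset.sum_le_sum fun i _ => hgf i _ (hx i)).trans
      (PositiveFunctional.sum_apply_le_sup' hι hfs x))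
end
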